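/- arXiv:1311.0365 — 7 statements merged into one kernel-verified Lean document; each statement's English description precedes it below -/
import Mathlib

section
/- For every nonnegative integer n, ((r+1)/π) ∫_0^{π/(r+1)} ( (sin((r+1)φ))^{r+1} / (sin φ (sin(rφ))^r) )^n dφ = binom((r+1)n, n). -/
open Real

/-- Expansion of `((1 + z) ^ m / z) ^ n` as a Laurent polynomial in `z`. -/
theorem sum_choose_mul_zpow_sub {K : Type*} [Field K] {z : K} (hz : z ≠ 0) (m n : ℕ) :
    ∑ j ∈ Finset.range (m * n + 1), ((m * n).choose j : K) * z ^ ((j : ℤ) - n) =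
      ((1 + z) ^ m / z) ^ n := by
  rw [div_pow, ← pow_mul, add_comm 1 z, add_pow, Finset.sum_div]
  refine Finset.sum_congr rfl fun j _ => ?_
  rw [zpow_sub₀ hz, zpow_natCast, zpow_natCast, one_pow]
  ring

/-- The point `z` with `arg z = c * φ` and modulus `a φ`. -/
noncomputable def polarCurve (a : ℝ → ℝ) (c φ : ℝ) : ℂ :=
  (a φ : ℂ) * Complex.exp ((c * φ : ℝ) * Complex.I)

/-- Imaginary part of a primitive of `z ^ k * (dz / z)` along `polarCurve a c`. -/
noncomputable def polarPrimitive (a : ℝ → ℝ) (c : ℝ) (k : ℤ) (φ : ℝ) : ℝ :=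
  if k = 0 then c * φ else (polarCurve a c φ ^ k).im / k

theorem polarCurve_ne_zero {a : ℝ → ℝ} {c φ : ℝ} (h : a φ ≠ 0) : polarCurve a c φ ≠ 0 :=
  mul_ne_zero (by exact_mod_cast h) (Complex.exp_ne_zero _)

theorem hasDerivAt_polarCurve {a : ℝ → ℝ} {a' c φ : ℝ} (ha : HasDerivAt a a' φ) (h : a φ ≠ 0) :
    HasDerivAt (polarCurve a c) (polarCurve a c φ * ((a' / a φ : ℝ) + c * Complex.I)) φ := by
  have h1 : HasDerivAt (fun x : ℝ => ((c * x : ℝ) : ℂ) * Complex.I) (c * Complex.I) φ := by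
    simpa using (((hasDerivAt_id φ).const_mul c).ofReal_comp).mul_const Complex.I
  refine (ha.ofReal_comp.mul h1.cexp).congr_deriv ?_
  have h' : (a φ : ℂ) ≠ 0 := by exact_mod_cast h
  unfold polarCurve
  push_cast
  field_simp

theorem hasDerivAt_polarPrimitive {a : ℝ → ℝ} {a' c φ : ℝ} (ha : HasDerivAt a a' φ)
    (h : a φ ≠ 0) (k : ℤ) :
    HasDerivAt (polarPrimitive a c k)
      (polarCurve a c φ ^ k * ((a' / a φ : ℝ) + c * Complex.I)).im φ := by
  by_cases hk : k = 0
  · subst hk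
    have : polarPrimitive a c 0 = fun x => c * x := by ext; simp [polarPrimitive]
    rw [this]
    simpa using (hasDerivAt_id φ).const_mul c
  · have : polarPrimitive a c k = fun x => (polarCurve a c x ^ k).im / k := by
      ext; simp [polarPrimitive, hk]
    rw [this]
    have hz := polarCurve_ne_zero (c := c) h
    have h1 := (hasDerivAt_zpow k _ (Or.inl hz)).comp_of_eq φ (hasDerivAt_polarCurve (c := c) ha h) rfl
    have h2 := (Complex.imCLM.hasFDerivAt.comp_hasDerivAt φ h1).div_const (k : ℝ)
    refine h2.congr_deriv ?_
    have hk' : (k : ℝ) ≠ 0 := by exact_mod_cast hk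
    rw [zpow_sub_one₀ hz, div_eq_iff hk', Complex.imCLM_apply, mul_comm _ (k : ℝ),
      ← Complex.im_ofReal_mul]
    congr 1
    push_cast
    field_simp

theorem polarPrimitive_zero (a : ℝ → ℝ) (c : ℝ) (k : ℤ) : polarPrimitive a c k 0 = 0 := by
  by_cases hk : k = 0
  · simp [polarPrimitive, hk]
  · simp [polarPrimitive, hk, polarCurve, ← Complex.ofReal_zpow]

theorem polarPrimitive_pi_div (a : ℝ → ℝ) {c : ℝ} (hc : c ≠ 0) (k : ℤ) :
    polarPrimitive a c k (π / c) = if k = 0 then π else 0 := by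
  by_cases hk : k = 0
  · simp [polarPrimitive, hk, mul_div_cancel₀ _ hc]
  · have : polarCurve a c (π / c) = ((-a (π / c) : ℝ) : ℂ) := by
      simp [polarCurve, mul_div_cancel₀ _ hc, Complex.exp_pi_mul_I]
    simp only [polarPrimitive, hk, if_false, this, ← Complex.ofReal_zpow, Complex.ofReal_im,
      zero_div]

theorem sin_mul_add_sin_mul_exp (r φ : ℝ) :
    (sin (r * φ) : ℂ) + sin φ * Complex.exp (((r + 1) * φ : ℝ) * Complex.I) =
      sin ((r + 1) * φ) * Complex.exp (φ * Complex.I) := by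
  have e : r * φ = (r + 1) * φ - φ := by ring
  rw [Complex.exp_mul_I, Complex.exp_mul_I, e, sin_sub]
  push_cast
  ring

theorem one_add_polarCurve_pow_div {a : ℝ → ℝ} {r : ℕ} {φ : ℝ} (hφ : sin φ ≠ 0)
    (hr : sin (r * φ) ≠ 0) (ha : a φ = sin φ / sin (r * φ)) :
    (1 + polarCurve a (r + 1) φ) ^ (r + 1) / polarCurve a (r + 1) φ =
      ((sin ((r + 1) * φ) ^ (r + 1) / (sin φ * sin (r * φ) ^ r) : ℝ) : ℂ) := by
  have hφ' : (sin φ : ℂ) ≠ 0 := by exact_mod_cast hφ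
  have hr' : (sin (r * φ) : ℂ) ≠ 0 := by exact_mod_cast hr
  have h1 : 1 + polarCurve a (r + 1) φ =
      sin ((r + 1) * φ) / sin (r * φ) * Complex.exp (φ * Complex.I) := by
    rw [div_mul_eq_mul_div, ← sin_mul_add_sin_mul_exp, polarCurve, ha, Complex.ofReal_div]
    field_simp
  have h2 : Complex.exp (φ * Complex.I) ^ (r + 1) =
      Complex.exp (((r + 1) * φ : ℝ) * Complex.I) := by
    rw [← Complex.exp_nat_mul]
    congr 1
    push_cast
    ring
  have h3 := Complex.exp_ne_zero (((r + 1) * φ : ℝ) * Complex.I)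
  rw [h1, mul_pow, h2, polarCurve, ha, mul_div_mul_right _ _ h3]
  rw [Complex.ofReal_div, Complex.ofReal_div, Complex.ofReal_mul, Complex.ofReal_pow,
    Complex.ofReal_pow, div_pow]
  field_simp
  ring

/-- A smooth extension of `sin φ / sin (r * φ)` to `φ = 0`. -/
noncomputable def sinRatio (r : ℕ) (φ : ℝ) : ℝ :=
  ((Polynomial.Chebyshev.U ℝ ((r : ℤ) - 1)).eval (cos φ))⁻¹

theorem chebyshevU_eval_cos_mul_sin (r : ℕ) (φ : ℝ) :
    (Polynomial.Chebyshev.U ℝ ((r : ℤ) - 1)).eval (cos φ) * sin φ = sin (r * φ) := by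
  rw [Polynomial.Chebyshev.U_real_cos]
  push_cast
  ring_nf

theorem sin_pos_of_mem_Ioc {r : ℕ} (hr : 1 ≤ r) {φ : ℝ}
    (hφ : φ ∈ Set.Ioc 0 (π / ((r : ℝ) + 1))) : 0 < sin φ ∧ 0 < sin (r * φ) := by
  have hr' : (1 : ℝ) ≤ r := by exact_mod_cast hr
  obtain ⟨h0, h1⟩ := hφ
  rw [le_div_iff₀ (by linarith)] at h1
  exact ⟨sin_pos_of_pos_of_lt_pi h0 (by nlinarith),
    sin_pos_of_pos_of_lt_pi (by positivity) (by nlinarith)⟩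

theorem sinRatio_eq {r : ℕ} {φ : ℝ} (hφ : sin φ ≠ 0) : sinRatio r φ = sin φ / sin (r * φ) := by
  rw [sinRatio, ← chebyshevU_eval_cos_mul_sin, div_mul_cancel_right₀ hφ]

theorem sinRatio_ne_zero {r : ℕ} (hr : 1 ≤ r) {φ : ℝ}
    (hφ : φ ∈ Set.Icc 0 (π / ((r : ℝ) + 1))) : sinRatio r φ ≠ 0 := by
  rcases hφ.1.eq_or_lt with rfl | h0
  · simp [sinRatio, Polynomial.Chebyshev.U_eval_one, Nat.one_le_iff_ne_zero.mp hr]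
  · obtain ⟨h1, h2⟩ := sin_pos_of_mem_Ioc hr ⟨h0, hφ.2⟩
    rw [sinRatio_eq h1.ne']
    positivity

theorem differentiableAt_sinRatio {r : ℕ} {φ : ℝ} (h : sinRatio r φ ≠ 0) :
    DifferentiableAt ℝ (sinRatio r) φ :=
  ((Polynomial.differentiable _ _).comp φ differentiable_cos.differentiableAt).inv
    fun h0 => h (inv_eq_zero.mpr h0)

/-- `((r+1)/π) ∫_0^{π/(r+1)} ρ(φ)^n dφ = binom((r+1)n, n)`. -/
theorem stmt_13 (r : ℕ) (hr : 1 ≤ r) (n : ℕ) :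
    ((r : ℝ) + 1) / π *
      ∫ φ in (0 : ℝ)..(π / ((r : ℝ) + 1)),
        (Real.sin (((r : ℝ) + 1) * φ) ^ (r + 1) /
          (Real.sin φ * Real.sin ((r : ℝ) * φ) ^ r)) ^ n =
      (Nat.choose ((r + 1) * n) n : ℝ) := by
  have hc : (0 : ℝ) < (r : ℝ) + 1 := by positivity
  have hT : 0 ≤ π / ((r : ℝ) + 1) := by positivity
  set F : ℝ → ℝ := fun φ => ∑ j ∈ Finset.range ((r + 1) * n + 1),
    (((r + 1) * n).choose j : ℝ) * polarPrimitive (sinRatio r) (r + 1) ((j : ℤ) - n) φ with hF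
  have hderiv : ∀ φ ∈ Set.Icc 0 (π / ((r : ℝ) + 1)), HasDerivAt F
      (∑ j ∈ Finset.range ((r + 1) * n + 1), (((r + 1) * n).choose j : ℝ) *
        (polarCurve (sinRatio r) (r + 1) φ ^ ((j : ℤ) - n) *
          ((deriv (sinRatio r) φ / sinRatio r φ : ℝ) + ((r + 1 : ℝ) : ℂ) * Complex.I)).im) φ :=
    fun φ hφ => HasDerivAt.fun_sum fun j _ =>
      (hasDerivAt_polarPrimitive (differentiableAt_sinRatio (sinRatio_ne_zero hr hφ)).hasDerivAt
        (sinRatio_ne_zero hr hφ) _).const_mul _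
  have hcont : ContinuousOn F (Set.Icc 0 (π / ((r : ℝ) + 1))) :=
    fun φ hφ => (hderiv φ hφ).continuousAt.continuousWithinAt
  have hderiv' : ∀ φ ∈ Set.Ioo 0 (π / ((r : ℝ) + 1)), HasDerivAt F
      (((r : ℝ) + 1) * (sin (((r : ℝ) + 1) * φ) ^ (r + 1) /
        (sin φ * sin ((r : ℝ) * φ) ^ r)) ^ n) φ := by
    intro φ hφ
    obtain ⟨h1, h2⟩ := sin_pos_of_mem_Ioc hr (Set.Ioo_subset_Ioc_self hφ)
    have ha := sinRatio_ne_zero hr (Set.Ioo_subset_Icc_self hφ)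
    refine (hderiv φ (Set.Ioo_subset_Icc_self hφ)).congr_deriv ?_
    simp_rw [← Complex.im_ofReal_mul, ← Complex.im_sum, ← mul_assoc, ← Finset.sum_mul,
      Complex.ofReal_natCast]
    rw [sum_choose_mul_zpow_sub (polarCurve_ne_zero ha),
      one_add_polarCurve_pow_div h1.ne' h2.ne' (sinRatio_eq h1.ne'), ← Complex.ofReal_pow,
      Complex.im_ofReal_mul]
    simp [mul_comm]
  have hint := intervalIntegral.integral_eq_sub_of_hasDerivAt_of_le hT hcont hderiv'
    ((intervalIntegrable_iff_integrableOn_Ioc_of_le hT).2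
      (intervalIntegral.integrableOn_deriv_of_nonneg hcont hderiv' fun φ hφ => by
        obtain ⟨h1, h2⟩ := sin_pos_of_mem_Ioc hr (Set.Ioo_subset_Ioc_self hφ)
        have h3 : 0 ≤ sin (((r : ℝ) + 1) * φ) :=
          sin_nonneg_of_nonneg_of_le_pi (mul_nonneg hc.le hφ.1.le)
            (by rw [mul_comm, ← le_div_iff₀ hc]; exact hφ.2.le)
        positivity))
  have hn : n ∈ Finset.range ((r + 1) * n + 1) := by
    rw [Finset.mem_range, Nat.lt_succ_iff]
    exact Nat.le_mul_of_pos_left n r.succ_pos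
  have hF0 : F 0 = 0 := by simp [hF, polarPrimitive_zero]
  have hFT : F (π / ((r : ℝ) + 1)) = (((r + 1) * n).choose n : ℝ) * π := by
    simp only [hF, polarPrimitive_pi_div _ hc.ne']
    rw [Finset.sum_eq_single_of_mem n hn fun j _ hj => by
      rw [if_neg (by omega), mul_zero]]
    simp
  rw [intervalIntegral.integral_const_mul, hF0, hFT, sub_zero] at hint
  rw [div_mul_eq_mul_div, hint, mul_div_cancel_right₀ _ pi_ne_zero]
end

section
/- For every nonnegative integer n, ∫_0^1 (sin(πφ))^{(r+1)n} / ( (sin(πφ/(r+1)))^n · (sin(rπφ/(r+1)))^{rn} ) dφ = binom((r+1)n, n). -/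
open Real

/-- A closed form for the integral over the upper half of a closed curve, given in polar form,
along which `(1 + z) ^ N / z ^ n` is real. -/
lemma integral_eq_choose_of_polar_curve {N n : ℕ} (hnN : n ≤ N) {ρ f : ℝ → ℝ}
    (hcont : ContinuousOn ρ (Set.Icc 0 1)) (hpos : ∀ x ∈ Set.Icc (0 : ℝ) 1, 0 < ρ x)
    (hdiff : ∀ x ∈ Set.Ioo (0 : ℝ) 1, DifferentiableAt ℝ ρ x)
    (hf : ∀ x ∈ Set.Ioo (0 : ℝ) 1, 0 ≤ f x)
    (hcurve : ∀ x ∈ Set.Ioo (0 : ℝ) 1,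
      (f x : ℂ) * (ρ x * Complex.exp (↑(π * x) * Complex.I)) ^ n =
        (1 + ρ x * Complex.exp (↑(π * x) * Complex.I)) ^ N) :
    ∫ x in (0 : ℝ)..1, f x = N.choose n := by
  let P : ℕ → ℝ → ℝ := fun k x => if k = n then π * x else
    ρ x ^ ((k : ℤ) - n) * sin (((k : ℤ) - n : ℤ) * (π * x)) / ((k : ℤ) - n : ℤ)
  have hP0 (k) : P k 0 = 0 := by simp [P]
  have hP1 (k) : P k 1 = if k = n then π else 0 := by
    simp only [P, mul_one, sin_int_mul_pi, mul_zero, zero_div]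
  have hPcont (k) : ContinuousOn (P k) (Set.Icc 0 1) := by
    by_cases hk : k = n
    · simp only [P, hk, if_true]
      fun_prop
    · simp only [P, hk, if_false]
      refine ((hcont.zpow₀ _ fun x hx => Or.inl (hpos x hx).ne').mul ?_).div_const _
      fun_prop
  have hPderiv (k) (x) (hx : x ∈ Set.Ioo (0 : ℝ) 1) : HasDerivAt (P k)
      (deriv ρ x / ρ x * (ρ x ^ ((k : ℤ) - n) * sin (((k : ℤ) - n : ℤ) * (π * x))) +
        π * (ρ x ^ ((k : ℤ) - n) * cos (((k : ℤ) - n : ℤ) * (π * x)))) x := by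
    have hρ : ρ x ≠ 0 := (hpos x (Set.Ioo_subset_Icc_self hx)).ne'
    by_cases hk : k = n
    · simp only [P, hk, if_true]
      simpa using (hasDerivAt_id x).const_mul π
    · simp only [P, hk, if_false]
      have hm : (((k : ℤ) - n : ℤ) : ℝ) ≠ 0 := by
        rw [Int.cast_ne_zero, sub_ne_zero]
        exact_mod_cast hk
      generalize (k : ℤ) - n = m at hm
      have h1 := (hasDerivAt_zpow m (ρ x) (Or.inl hρ)).comp x (hdiff x hx).hasDerivAt
      have h2 := (((hasDerivAt_id x).const_mul π).const_mul (m : ℝ)).sin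
      refine ((h1.mul h2).div_const (m : ℝ)).congr_deriv ?_
      simp only [Function.comp_apply, id, zpow_sub_one₀ hρ]
      field_simp
  have hsum (x) (hx : x ∈ Set.Ioo (0 : ℝ) 1) :
      (f x : ℂ) = ∑ k ∈ Finset.range (N + 1), (N.choose k : ℂ) *
        ((ρ x ^ ((k : ℤ) - n) : ℝ) *
          Complex.exp (↑((((k : ℤ) - n : ℤ) : ℝ) * (π * x)) * Complex.I)) := by
    have hρ : (ρ x : ℂ) ≠ 0 := by
      exact_mod_cast (hpos x (Set.Ioo_subset_Icc_self hx)).ne'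
    have hz : (ρ x : ℂ) * Complex.exp (↑(π * x) * Complex.I) ≠ 0 :=
      mul_ne_zero hρ (Complex.exp_ne_zero _)
    rw [eq_div_of_mul_eq (pow_ne_zero n hz) (hcurve x hx), add_comm, add_pow, Finset.sum_div]
    refine Finset.sum_congr rfl fun k _ => ?_
    have he : Complex.exp (↑((((k : ℤ) - n : ℤ) : ℝ) * (π * x)) * Complex.I) =
        Complex.exp (↑(π * x) * Complex.I) ^ ((k : ℤ) - n) := by
      rw [← Complex.exp_int_mul]
      push_cast
      ring_nf
    rw [he, Complex.ofReal_zpow, ← mul_zpow, zpow_sub₀ hz, zpow_natCast, zpow_natCast]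
    simp only [one_pow, mul_one]
    ring
  have hre (x) (hx : x ∈ Set.Ioo (0 : ℝ) 1) :
      ∑ k ∈ Finset.range (N + 1), (N.choose k : ℝ) *
        (ρ x ^ ((k : ℤ) - n) * cos (((k : ℤ) - n : ℤ) * (π * x))) = f x := by
    have h := congrArg Complex.re (hsum x hx)
    simp only [Complex.re_sum, ← Complex.ofReal_natCast, Complex.re_ofReal_mul,
      Complex.exp_ofReal_mul_I_re, Complex.ofReal_re] at h
    exact h.symm
  have him (x) (hx : x ∈ Set.Ioo (0 : ℝ) 1) :
      ∑ k ∈ Finset.range (N + 1), (N.choose k : ℝ) *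
        (ρ x ^ ((k : ℤ) - n) * sin (((k : ℤ) - n : ℤ) * (π * x))) = 0 := by
    have h := congrArg Complex.im (hsum x hx)
    simp only [Complex.im_sum, ← Complex.ofReal_natCast, Complex.im_ofReal_mul,
      Complex.exp_ofReal_mul_I_im, Complex.ofReal_im] at h
    exact h.symm
  let F : ℝ → ℝ := fun x => ∑ k ∈ Finset.range (N + 1), (N.choose k : ℝ) * P k x
  have hFcont : ContinuousOn F (Set.Icc 0 1) :=
    continuousOn_finsetSum _ fun k _ => (hPcont k).const_mul _
  have hFderiv (x) (hx : x ∈ Set.Ioo (0 : ℝ) 1) : HasDerivAt F (π * f x) x := by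
    refine (HasDerivAt.fun_sum fun k _ =>
      (hPderiv k x hx).const_mul (N.choose k : ℝ)).congr_deriv ?_
    trans deriv ρ x / ρ x * 0 + π * f x
    · rw [← him x hx, ← hre x hx, Finset.mul_sum, Finset.mul_sum, ← Finset.sum_add_distrib]
      exact Finset.sum_congr rfl fun k _ => by ring
    · ring
  have hint : IntervalIntegrable (fun x => π * f x) MeasureTheory.volume 0 1 := by
    apply intervalIntegral.intervalIntegrable_deriv_of_nonneg (g := F)
    · rwa [Set.uIcc_of_le zero_le_one]
    · simpa using fun x h0 h1 => hFderiv x ⟨h0, h1⟩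
    · simpa using fun x h0 h1 => mul_nonneg pi_pos.le (hf x ⟨h0, h1⟩)
  have h := intervalIntegral.integral_eq_sub_of_hasDerivAt_of_le zero_le_one hFcont hFderiv hint
  rw [intervalIntegral.integral_const_mul] at h
  have hF : F 1 - F 0 = π * N.choose n := by
    simp [F, hP0, hP1, Nat.lt_succ_of_le hnN, mul_comm]
  exact mul_left_cancel₀ pi_ne_zero (h.trans hF)

lemma Real.sinc_pos_of_nonneg_of_lt_pi {x : ℝ} (h0 : 0 ≤ x) (hx : x < π) : 0 < sinc x := by
  rcases h0.eq_or_lt with rfl | h0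
  · simp
  · rw [sinc_of_ne_zero h0.ne']
    exact div_pos (sin_pos_of_pos_of_lt_pi h0 hx) h0

lemma Real.differentiableAt_sinc {x : ℝ} (hx : x ≠ 0) : DifferentiableAt ℝ sinc x := by
  have h : sinc =ᶠ[nhds x] fun y => sin y / y := by
    filter_upwards [isOpen_ne.mem_nhds hx] with y hy using sinc_of_ne_zero hy
  exact (differentiableAt_sin.div differentiableAt_id hx).congr_of_eventuallyEq h

/-- The law of sines in complex form. -/
lemma one_add_sin_div_sin_mul_exp {a b : ℝ} (hb : sin b ≠ 0) :
    1 + ((sin a / sin b : ℝ) : ℂ) * Complex.exp (↑(a + b) * Complex.I) =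
      ((sin (a + b) / sin b : ℝ) : ℂ) * Complex.exp (a * Complex.I) := by
  apply Complex.ext
  · simp only [Complex.add_re, Complex.one_re, Complex.re_ofReal_mul, Complex.exp_ofReal_mul_I_re]
    field_simp
    rw [sin_add, cos_add]
    linear_combination -sin b * sin_sq_add_cos_sq a
  · simp only [Complex.add_im, Complex.one_im, Complex.im_ofReal_mul, Complex.exp_ofReal_mul_I_im]
    ring

/-- `∫_0^1 (sin πφ)^{(r+1)n} / ((sin(πφ/(r+1)))^n (sin(rπφ/(r+1)))^{rn}) dφ
    = binom((r+1)n, n)`. -/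
theorem stmt_14 (r : ℕ) (hr : 1 ≤ r) (n : ℕ) :
    (∫ φ in (0 : ℝ)..1,
      Real.sin (π * φ) ^ ((r + 1) * n) /
        (Real.sin (π * φ / ((r : ℝ) + 1)) ^ n *
          Real.sin ((r : ℝ) * π * φ / ((r : ℝ) + 1)) ^ (r * n))) =
      (Nat.choose ((r + 1) * n) n : ℝ) := by
  have hr0 : (0 : ℝ) < r := by exact_mod_cast hr
  have hlt {c x : ℝ} (hc : c < r + 1) (hx : x ∈ Set.Icc (0 : ℝ) 1) :
      c * π * x / (r + 1) < π := by
    rw [div_lt_iff₀ (by positivity)]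
    have : c * x < r + 1 := by
      rcases le_total 0 c with h | h
      · exact (mul_le_of_le_one_right h hx.2).trans_lt hc
      · exact (mul_nonpos_of_nonpos_of_nonneg h hx.1).trans_lt (by positivity)
    nlinarith [pi_pos]
  have hlt1 {x : ℝ} (hx : x ∈ Set.Icc (0 : ℝ) 1) : π * x / (r + 1) < π := by
    simpa using hlt (c := 1) (by linarith) hx
  have hltr {x : ℝ} (hx : x ∈ Set.Icc (0 : ℝ) 1) : r * π * x / (r + 1) < π :=
    hlt (by linarith) hx
  have hsinc {x : ℝ} (hx : x ∈ Set.Icc (0 : ℝ) 1) : 0 < sinc (r * π * x / (r + 1)) :=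
    sinc_pos_of_nonneg_of_lt_pi (div_nonneg (mul_nonneg (by positivity) hx.1) (by positivity))
      (hltr hx)
  have hsin {x : ℝ} (hx : x ∈ Set.Ioo (0 : ℝ) 1) :
      0 < sin (π * x / (r + 1)) ∧ 0 < sin (r * π * x / (r + 1)) := by
    have hx0 := hx.1
    have hx' := Set.Ioo_subset_Icc_self hx
    exact ⟨sin_pos_of_pos_of_lt_pi (by positivity) (hlt1 hx'),
      sin_pos_of_pos_of_lt_pi (by positivity) (hltr hx')⟩
  refine integral_eq_choose_of_polar_curve
    (ρ := fun x => sinc (π * x / (r + 1)) / (r * sinc (r * π * x / (r + 1))))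
    (Nat.le_mul_of_pos_left n r.succ_pos) ?_ ?_ ?_ ?_ ?_
  · refine ContinuousOn.div ?_ ?_ fun x hx => (mul_pos hr0 (hsinc hx)).ne'
    · exact (continuous_sinc.comp (by fun_prop)).continuousOn
    · exact (continuous_const.mul (continuous_sinc.comp (by fun_prop))).continuousOn
  · intro x hx
    exact div_pos (sinc_pos_of_nonneg_of_lt_pi
      (div_nonneg (mul_nonneg pi_pos.le hx.1) (by positivity)) (hlt1 hx))
      (mul_pos hr0 (hsinc hx))
  · intro x hx
    have hx0 := hx.1
    have h1 : DifferentiableAt ℝ (fun x => sinc (π * x / (r + 1))) x :=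
      DifferentiableAt.fun_comp' x (differentiableAt_sinc (by positivity)) (by fun_prop)
    have h2 : DifferentiableAt ℝ (fun x => sinc (r * π * x / (r + 1))) x :=
      DifferentiableAt.fun_comp' x (differentiableAt_sinc (by positivity)) (by fun_prop)
    exact h1.fun_div (h2.const_mul _) (mul_pos hr0 (hsinc (Set.Ioo_subset_Icc_self hx))).ne'
  · intro x hx
    have h := sin_nonneg_of_nonneg_of_le_pi (mul_nonneg pi_pos.le hx.1.le)
      (mul_le_of_le_one_right pi_pos.le hx.2.le)
    have := hsin hx
    exact div_nonneg (pow_nonneg h _)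
      (mul_nonneg (pow_nonneg this.1.le _) (pow_nonneg this.2.le _))
  · intro x hx
    have hx0 := hx.1
    obtain ⟨ha, hb⟩ := hsin hx
    have hρ : sinc (π * x / (r + 1)) / (r * sinc (r * π * x / (r + 1))) =
        sin (π * x / (r + 1)) / sin (r * π * x / (r + 1)) := by
      rw [sinc_of_ne_zero (by positivity), sinc_of_ne_zero (by positivity)]
      field_simp
    have hadd : π * x = π * x / (r + 1) + r * π * x / (r + 1) := by
      field_simp
      ring
    have hexp : Complex.exp (↑(π * x) * Complex.I) =
        Complex.exp (↑(π * x / (r + 1)) * Complex.I) ^ (r + 1) := by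
      rw [← Complex.exp_nat_mul]
      congr 1
      have : (r : ℂ) + 1 ≠ 0 := by exact_mod_cast r.succ_ne_zero
      push_cast
      field_simp
    have hlaw := one_add_sin_div_sin_mul_exp (a := π * x / (r + 1)) hb.ne'
    rw [← hadd] at hlaw
    simp only [hρ]
    rw [hlaw, hexp]
    generalize sin (π * x / (r + 1)) = s at *
    generalize sin (r * π * x / (r + 1)) = t at *
    have hs : (s : ℂ) ≠ 0 := by exact_mod_cast ha.ne'
    have ht : (t : ℂ) ≠ 0 := by exact_mod_cast hb.ne'
    push_cast
    simp only [pow_mul, ← mul_pow, ← div_pow]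
    congr 1
    rw [mul_pow, div_pow]
    field_simp
    rw [Nat.succ_eq_add_one]
    ring
end

section
/- For every φ ∈ (0, π/(r+1)), the complex numbers w = (sin((r+1)φ)/sin(rφ)) e^{iφ} and w = (sin((r+1)φ)/sin(rφ)) e^{−iφ} are roots of the trinomial equation w^{r+1} − x w + x = 0 with x = ρ(φ). -/
open Real

theorem sin_mul_exp_pow_succ_sub_add (r : ℕ) (a : ℂ) :
    Complex.sin a * Complex.exp (Complex.I * a) ^ (r + 1)
      - Complex.sin (((r : ℂ) + 1) * a) * Complex.exp (Complex.I * a)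
      + Complex.sin ((r : ℂ) * a) = 0 := by
  have hpow : Complex.exp (Complex.I * a) ^ (r + 1) =
      Complex.exp (((r : ℂ) * a) * Complex.I) * Complex.exp (a * Complex.I) := by
    rw [← Complex.exp_nat_mul, ← Complex.exp_add]
    congr 1
    push_cast
    ring
  rw [hpow, mul_comm Complex.I a, add_mul, one_mul, Complex.sin_add,
    Complex.exp_mul_I, Complex.exp_mul_I]
  linear_combination Complex.sin a ^ 2 * Complex.sin (r * a) * Complex.I_sq
    - Complex.sin (r * a) * Complex.sin_sq_add_cos_sq a

theorem trinomial_eq_zero {K : Type*} [Field K] {s S T E : K} (n : ℕ) (hs : s ≠ 0) (hT : T ≠ 0)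
    (h : s * E ^ (n + 1) - S * E + T = 0) :
    (S / T * E) ^ (n + 1) - S ^ (n + 1) / (s * T ^ n) * (S / T * E)
      + S ^ (n + 1) / (s * T ^ n) = 0 := by
  have key : (S / T * E) ^ (n + 1) - S ^ (n + 1) / (s * T ^ n) * (S / T * E)
      + S ^ (n + 1) / (s * T ^ n)
      = S ^ (n + 1) / (s * T ^ (n + 1)) * (s * E ^ (n + 1) - S * E + T) := by
    rw [mul_pow, div_pow]
    field_simp
    ring
  rw [key, h, mul_zero]

/-- The complex numbers `(sin((r+1)φ)/sin(rφ)) e^{±iφ}` are roots of the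
trinomial equation `w^{r+1} − x w + x = 0` with `x = ρ(φ)`. -/
theorem stmt_15 (r : ℕ) (hr : 1 ≤ r) (φ : ℝ) (hφ1 : 0 < φ) (hφ2 : φ < π / ((r : ℝ) + 1))
    (x w₁ w₂ : ℂ)
    (hx : x = ((Real.sin (((r : ℝ) + 1) * φ) ^ (r + 1) /
      (Real.sin φ * Real.sin ((r : ℝ) * φ) ^ r) : ℝ) : ℂ))
    (hw₁ : w₁ = ((Real.sin (((r : ℝ) + 1) * φ) / Real.sin ((r : ℝ) * φ) : ℝ) : ℂ) *
      Complex.exp (Complex.I * (φ : ℂ)))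
    (hw₂ : w₂ = ((Real.sin (((r : ℝ) + 1) * φ) / Real.sin ((r : ℝ) * φ) : ℝ) : ℂ) *
      Complex.exp (-Complex.I * (φ : ℂ))) :
    w₁ ^ (r + 1) - x * w₁ + x = 0 ∧ w₂ ^ (r + 1) - x * w₂ + x = 0 := by
  have hr' : (1 : ℝ) ≤ r := by exact_mod_cast hr
  have hφ : ((r : ℝ) + 1) * φ < π := by
    rwa [lt_div_iff₀' (by positivity)] at hφ2
  have hs : Complex.sin φ ≠ 0 := by
    exact_mod_cast (Real.sin_pos_of_pos_of_lt_pi hφ1 (by nlinarith)).ne'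
  have hT : Complex.sin (r * φ) ≠ 0 := by
    exact_mod_cast (Real.sin_pos_of_pos_of_lt_pi (by positivity : 0 < (r : ℝ) * φ)
      (by nlinarith)).ne'
  subst hx hw₁ hw₂
  push_cast
  refine ⟨trinomial_eq_zero r hs hT (sin_mul_exp_pow_succ_sub_add r φ),
    trinomial_eq_zero r hs hT ?_⟩
  have h := sin_mul_exp_pow_succ_sub_add r (-φ)
  rw [mul_neg, mul_neg, mul_neg, Complex.sin_neg, Complex.sin_neg, Complex.sin_neg,
    ← neg_mul Complex.I] at h
  linear_combination -h
end

section
/- For every real z > (r+1)^{r+1}/r^r, the polynomial w ↦ w^{r+1} − z w + z has exactly two positive real roots. -/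
open Real

theorem StrictConvexOn.neg_of_between {s : Set ℝ} {f : ℝ → ℝ} (hf : StrictConvexOn ℝ s f)
    {a b c : ℝ} (ha : a ∈ s) (hc : c ∈ s) (hab : a < b) (hbc : b < c)
    (hfa : f a ≤ 0) (hfc : f c ≤ 0) : f b < 0 := by
  have hb : b ∈ openSegment ℝ a c := by
    rw [openSegment_eq_Ioo (hab.trans hbc)]
    exact ⟨hab, hbc⟩
  exact (hf.lt_on_openSegment ha hc (hab.trans hbc).ne hb).trans_le (max_le hfa hfc)

/-- A strictly convex function that takes a negative value between two positive ones has exactly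
two zeros. -/
theorem StrictConvexOn.exists_two_zeros {s : Set ℝ} {f : ℝ → ℝ} (hf : StrictConvexOn ℝ s f)
    {a c b : ℝ} (ha : a ∈ s) (hb : b ∈ s) (hac : a < c) (hcb : c < b)
    (hcont : ContinuousOn f (Set.Icc a b)) (hfa : 0 < f a) (hfc : f c < 0) (hfb : 0 < f b) :
    ∃ x ∈ Set.Ioo a c, ∃ y ∈ Set.Ioo c b, ∀ w ∈ s, f w = 0 ↔ w = x ∨ w = y := by
  obtain ⟨x, hx, hfx⟩ := intermediate_value_Ioo' hac.le
    (hcont.mono (Set.Icc_subset_Icc_right hcb.le)) ⟨hfc, hfa⟩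
  obtain ⟨y, hy, hfy⟩ := intermediate_value_Ioo hcb.le
    (hcont.mono (Set.Icc_subset_Icc_left hac.le)) ⟨hfc, hfb⟩
  have mem {t : ℝ} (h₁ : a ≤ t) (h₂ : t ≤ b) : t ∈ s :=
    hf.1.ordConnected.out ha hb ⟨h₁, h₂⟩
  have hcs : c ∈ s := mem hac.le hcb.le
  have hxs : x ∈ s := mem hx.1.le (hx.2.trans hcb).le
  have hys : y ∈ s := mem (hac.trans hy.1).le hy.2.le
  refine ⟨x, hx, y, hy, fun w hw => ⟨fun hfw => ?_, ?_⟩⟩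
  · rcases lt_trichotomy w x with h | h | h
    · exact absurd hfx (hf.neg_of_between hw hcs h hx.2 hfw.le hfc.le).ne
    · exact Or.inl h
    · rcases lt_trichotomy w y with h' | h' | h'
      · exact absurd hfw (hf.neg_of_between hxs hys h h' hfx.le hfy.le).ne
      · exact Or.inr h'
      · exact absurd hfy (hf.neg_of_between hcs hw hy.1 h' hfc.le hfw.le).ne
  · rintro (rfl | rfl) <;> assumption

/-- For `z > (r+1)^{r+1}/r^r`, the polynomial `w ↦ w^{r+1} − z w + z` has
exactly two positive real roots. -/
theorem stmt_16 (r : ℕ) (hr : 1 ≤ r) (z : ℝ)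
    (hz : ((r : ℝ) + 1) ^ (r + 1) / (r : ℝ) ^ r < z) :
    ∃ w₁ w₂ : ℝ, 0 < w₁ ∧ 0 < w₂ ∧ w₁ ≠ w₂ ∧
      (∀ w : ℝ, 0 < w → (w ^ (r + 1) - z * w + z = 0 ↔ w = w₁ ∨ w = w₂)) := by
  have hr₁ : (1 : ℝ) ≤ r := by exact_mod_cast hr
  have hr₀ : (0 : ℝ) < r := by linarith
  obtain ⟨c, hc⟩ : ∃ c : ℝ, c = (r + 1) / r := ⟨_, rfl⟩
  have hrc : r * c = r + 1 := by rw [hc]; field_simp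
  have hc₁ : 1 < c := by rw [hc, one_lt_div hr₀]; linarith
  have hz' : r * c ^ (r + 1) < z := by
    convert hz using 1
    rw [hc, div_pow, pow_succ (r : ℝ) r]
    field_simp
  have hcpow : c ≤ c ^ (r + 1) := le_self_pow₀ hc₁.le (by lia)
  have hcz : c < z := by nlinarith
  have hconv : StrictConvexOn ℝ (Set.Ici 0) fun w : ℝ => w ^ (r + 1) - z * w + z := by
    have hlin : ConvexOn ℝ (Set.Ici (0 : ℝ)) fun w : ℝ => -z * w + z :=
      ⟨convex_Ici 0, fun x _ y _ a b _ _ hab => by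
        simp only [smul_eq_mul]
        linear_combination (-z) * hab⟩
    refine ((strictConvexOn_pow (n := r + 1) (by lia)).add_convexOn hlin).congr fun w _ => ?_
    simp only [Pi.add_apply]
    ring
  have hfc : c ^ (r + 1) - z * c + z < 0 := by
    have : r * (c ^ (r + 1) - z * c + z) < 0 := by
      linear_combination hz' - z * hrc
    exact (pos_iff_neg_of_mul_neg this).1 hr₀
  have hfz : 0 < z ^ (r + 1) - z * z + z := by
    have : z ^ 2 ≤ z ^ (r + 1) := pow_le_pow_right₀ (by linarith) (by lia)
    nlinarith
  obtain ⟨x, hx, y, hy, h⟩ := hconv.exists_two_zeros (a := 0) (c := c) (b := z)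
    Set.self_mem_Ici (Set.mem_Ici.2 (by linarith)) (by linarith) hcz (by fun_prop)
    (by simp; linarith) hfc hfz
  exact ⟨x, y, hx.1, by linarith [hy.1], (hx.2.trans hy.1).ne, fun w hw => h w hw.le⟩
end

section
/- For every x ∈ ℂ and every n ∈ ℕ, F_n(x) = (1/(2π)^r) ∫_{[−π,π]^r} exp( Σ_{j=1}^r e^{i t_j} ) · ( 1 − x e^{−i(t_1 + … + t_r)} )^n · e^{−i(ν_1 t_1 + … + ν_r t_r)} dt_1 ⋯ dt_r. -/
open Real MeasureTheory

lemma integral_exp_I_mul_int (m : ℤ) :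
    ∫ t in (-π)..π, Complex.exp (Complex.I * m * (t : ℂ)) = if m = 0 then 2 * (π : ℂ) else 0 := by
  split_ifs with h
  · subst h
    simp
    ring
  · have hc : Complex.I * (m : ℂ) ≠ 0 := by simp [h]
    rw [integral_exp_mul_complex hc, div_eq_zero_iff, sub_eq_zero]
    left
    rw [Complex.exp_eq_exp_iff_exists_int]
    exact ⟨m, by push_cast; ring⟩

/-- Cauchy's coefficient formula on the unit circle for the exponential function. -/
lemma integral_exp_exp_I_mul (m : ℕ) :
    ∫ t in (-π)..π, Complex.exp (Complex.exp (Complex.I * (t : ℂ))) *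
      Complex.exp (-Complex.I * (m * (t : ℂ))) = 2 * (π : ℂ) / (m.factorial : ℂ) := by
  have key : HasSum (fun k : ℕ => ∫ t in (-π)..π,
      ((k.factorial : ℂ)⁻¹ * Complex.exp (Complex.I * ((k : ℤ) - (m : ℤ) : ℤ) * (t : ℂ))))
      (∫ t in (-π)..π, Complex.exp (Complex.exp (Complex.I * (t : ℂ))) *
        Complex.exp (-Complex.I * (m * (t : ℂ)))) := by
    refine intervalIntegral.hasSum_integral_of_dominated_convergence
      (fun k _ => ((k.factorial : ℝ))⁻¹) (fun k => ?_) (fun k => ?_) ?_ ?_ ?_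
    · exact Continuous.aestronglyMeasurable (by fun_prop)
    · refine Filter.Eventually.of_forall fun t _ => ?_
      rw [norm_mul, Complex.norm_exp]
      simp
    · refine Filter.Eventually.of_forall fun t _ => ?_
      simpa using Real.summable_pow_div_factorial 1
    · simp
    · refine Filter.Eventually.of_forall fun t _ => ?_
      have h := (NormedSpace.expSeries_div_hasSum_exp
        (Complex.exp (Complex.I * (t : ℂ)))).mul_right (Complex.exp (-Complex.I * (m * (t : ℂ))))
      rw [← Complex.exp_eq_exp_ℂ] at h
      refine h.congr_fun fun k => ?_
      rw [← Complex.exp_nat_mul, div_mul_eq_mul_div, ← Complex.exp_add, div_eq_inv_mul]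
      congr 2
      push_cast
      ring
  simp_rw [intervalIntegral.integral_const_mul, integral_exp_I_mul_int] at key
  have single := hasSum_ite_eq m (2 * (π : ℂ) / (m.factorial : ℂ))
  refine key.unique ?_
  convert single using 2 with k
  by_cases hk : k = m
  · subst hk
    simp [div_eq_inv_mul]
  · simp [hk, sub_eq_zero]

/-- Multivariate contour-integral representation of `F_n` over `[−π,π]^r`. -/
theorem stmt_17 (r : ℕ) (hr : 1 ≤ r) (ν : Fin r → ℕ)
    (F : ℕ → ℂ → ℂ)
    (hF : ∀ n x, F n x = ∑ k ∈ Finset.range (n + 1),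
      (n.choose k : ℂ) * (-x) ^ k / ∏ j, ((k + ν j).factorial : ℂ))
    (x : ℂ) (n : ℕ) :
    F n x = (1 / (2 * (π : ℂ)) ^ r) *
      ∫ t in Set.univ.pi fun _ : Fin r => Set.Icc (-π) π,
        Complex.exp (∑ j, Complex.exp (Complex.I * (t j : ℂ))) *
          (1 - x * Complex.exp (-Complex.I * ∑ j, (t j : ℂ))) ^ n *
          Complex.exp (-Complex.I * ∑ j, ((ν j : ℂ) * (t j : ℂ))) := by
  have expand : ∀ t : Fin r → ℝ,
      Complex.exp (∑ j, Complex.exp (Complex.I * (t j : ℂ))) *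
          (1 - x * Complex.exp (-Complex.I * ∑ j, (t j : ℂ))) ^ n *
          Complex.exp (-Complex.I * ∑ j, ((ν j : ℂ) * (t j : ℂ))) =
      ∑ k ∈ Finset.range (n + 1), ((n.choose k : ℂ) * (-x) ^ k) *
        ∏ j, (Complex.exp (Complex.exp (Complex.I * (t j : ℂ))) *
          Complex.exp (-Complex.I * ((k + ν j : ℕ) * (t j : ℂ)))) := by
    intro t
    rw [sub_eq_add_neg, add_comm, add_pow, Finset.mul_sum, Finset.sum_mul]
    refine Finset.sum_congr rfl fun k _ => ?_
    have h : ∏ j, Complex.exp (-Complex.I * ((k + ν j : ℕ) * (t j : ℂ))) =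
        Complex.exp (-Complex.I * ∑ j, (t j : ℂ)) ^ k *
          Complex.exp (-Complex.I * ∑ j, ((ν j : ℂ) * (t j : ℂ))) := by
      rw [← Complex.exp_sum, ← Complex.exp_nat_mul, ← Complex.exp_add, Finset.mul_sum,
        Finset.mul_sum, Finset.mul_sum, ← Finset.sum_add_distrib]
      congr 1
      refine Finset.sum_congr rfl fun j _ => ?_
      push_cast
      ring
    rw [Finset.prod_mul_distrib, h, ← Complex.exp_sum, ← neg_mul, mul_pow, one_pow]
    ring
  have hint : ∀ k : ℕ, ∫ t in Set.univ.pi fun _ : Fin r => Set.Icc (-π) π,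
      ∏ j, (Complex.exp (Complex.exp (Complex.I * (t j : ℂ))) *
          Complex.exp (-Complex.I * ((k + ν j : ℕ) * (t j : ℂ)))) =
      (2 * (π : ℂ)) ^ r / ∏ j, ((k + ν j).factorial : ℂ) := by
    intro k
    rw [volume_pi, Measure.restrict_pi_pi, integral_fintype_prod_eq_prod (fun j (s : ℝ) =>
      Complex.exp (Complex.exp (Complex.I * (s : ℂ))) *
          Complex.exp (-Complex.I * ((k + ν j : ℕ) * (s : ℂ))))]
    simp_rw [integral_Icc_eq_integral_Ioc,
      ← intervalIntegral.integral_of_le (neg_le_self pi_pos.le), integral_exp_exp_I_mul]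
    simp [Finset.prod_div_distrib]
  simp_rw [expand]
  rw [integral_finsetSum]
  · simp_rw [integral_const_mul, hint, hF, Finset.mul_sum]
    refine Finset.sum_congr rfl fun k _ => ?_
    have hpi : (π : ℂ) ≠ 0 := by exact_mod_cast pi_ne_zero
    field_simp
  · intro k _
    refine ContinuousOn.integrableOn_compact (isCompact_univ_pi fun _ => isCompact_Icc) ?_
    exact Continuous.continuousOn (by fun_prop)
end

section
/- For every φ ∈ (0, π/(r+1)) and every n ≥ 1, writing A = sin((r+1)φ)/sin(rφ), one has F_n(n^r ρ(φ)) = (1/(2π)^r) · (sin(rφ)/(n sin((r+1)φ)))^{ν_1+…+ν_r} · ∫_{[−π,π]^r} [ exp( A Σ_{j=1}^r e^{i t_j} ) · ( 1 − (sin((r+1)φ)/sin φ) e^{−i(t_1+…+t_r)} ) ]^n · e^{−i(ν_1 t_1 + … + ν_r t_r)} dt_1 ⋯ dt_r. -/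
open Real MeasureTheory

theorem setIntegral_exp_mul_exp_mul_exp_neg (a : ℂ) (m : ℕ) :
    ∫ t in Set.Icc (-π) π, Complex.exp (a * Complex.exp (Complex.I * (t : ℂ))) *
      Complex.exp (-Complex.I * (m * (t : ℂ))) = 2 * π * (a ^ m / m.factorial) := by
  have hcauchy := DifferentiableOn.circleIntegral_one_div_sub_center_pow_smul (c := 0)
    (f := fun z : ℂ => Complex.exp (a * z)) one_pos m
    (Differentiable.differentiableOn (by fun_prop))
  rw [iteratedDeriv_cexp_const_mul] at hcauchy
  have hper : Function.Periodic (fun t : ℝ => Complex.exp (a * Complex.exp (Complex.I * (t : ℂ))) *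
      Complex.exp (-Complex.I * (m * (t : ℂ)))) (2 * π) := by
    intro t
    have h1 : Complex.exp (Complex.I * ((t + 2 * π : ℝ) : ℂ)) =
        Complex.exp (Complex.I * (t : ℂ)) := by
      rw [← Complex.exp_periodic (Complex.I * (t : ℂ))]
      congr 1
      push_cast
      ring
    have h2 : Complex.exp (-Complex.I * (m * ((t + 2 * π : ℝ) : ℂ))) =
        Complex.exp (-Complex.I * (m * (t : ℂ))) := by
      rw [← Complex.exp_periodic.sub_nat_mul_eq m (x := -Complex.I * (m * (t : ℂ)))]
      congr 1
      push_cast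
      ring
    simp only [h1, h2]
  have hshift := hper.intervalIntegral_add_eq (-π) 0
  rw [show -π + 2 * π = π by ring, zero_add] at hshift
  rw [integral_Icc_eq_integral_Ioc, ← intervalIntegral.integral_of_le (by linarith [pi_pos]),
    hshift]
  have hcircle : (∮ z in C(0, 1), (1 / (z - 0) ^ (m + 1)) • Complex.exp (a * z)) =
      Complex.I * ∫ t in 0..2 * π, Complex.exp (a * Complex.exp (Complex.I * (t : ℂ))) *
        Complex.exp (-Complex.I * (m * (t : ℂ))) := by
    rw [circleIntegral, ← intervalIntegral.integral_const_mul]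
    refine intervalIntegral.integral_congr fun t _ => ?_
    have h : Complex.exp (-Complex.I * (m * (t : ℂ))) =
        (Complex.exp (Complex.I * (t : ℂ)) ^ m)⁻¹ := by
      rw [← Complex.exp_nat_mul, ← Complex.exp_neg]
      congr 1
      ring
    have hne := Complex.exp_ne_zero (Complex.I * (t : ℂ))
    simp only [deriv_circleMap, circleMap, Complex.ofReal_one, one_mul, zero_add, sub_zero,
      smul_eq_mul, h, mul_comm (t : ℂ) Complex.I]
    field_simp
    ring
  rw [hcircle] at hcauchy
  refine mul_left_cancel₀ Complex.I_ne_zero (hcauchy.trans ?_)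
  simp
  ring

theorem setIntegral_exp_mul_one_sub_pow {r : ℕ} (ν : Fin r → ℕ) (a b : ℂ) (n : ℕ) :
    ∫ t in Set.univ.pi fun _ : Fin r => Set.Icc (-π) π,
        (Complex.exp (a * ∑ j, Complex.exp (Complex.I * (t j : ℂ))) *
            (1 - b * Complex.exp (-Complex.I * ∑ j, (t j : ℂ)))) ^ n *
          Complex.exp (-Complex.I * ∑ j, ((ν j : ℂ) * (t j : ℂ))) =
      ∑ k ∈ Finset.range (n + 1), n.choose k * (-b) ^ k *
        ∏ j, (2 * π * ((n * a) ^ (k + ν j) / (k + ν j).factorial)) := by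
  have hexpand (t : Fin r → ℝ) :
      (Complex.exp (a * ∑ j, Complex.exp (Complex.I * (t j : ℂ))) *
            (1 - b * Complex.exp (-Complex.I * ∑ j, (t j : ℂ)))) ^ n *
          Complex.exp (-Complex.I * ∑ j, ((ν j : ℂ) * (t j : ℂ))) =
      ∑ k ∈ Finset.range (n + 1), n.choose k * (-b) ^ k *
        ∏ j, (Complex.exp (n * a * Complex.exp (Complex.I * (t j : ℂ))) *
          Complex.exp (-Complex.I * ((k + ν j : ℕ) * (t j : ℂ)))) := by
    rw [mul_pow, sub_eq_neg_add, add_pow, Finset.mul_sum, Finset.sum_mul]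
    refine Finset.sum_congr rfl fun k _ => ?_
    have hprod : ∏ j, (Complex.exp (n * a * Complex.exp (Complex.I * (t j : ℂ))) *
          Complex.exp (-Complex.I * ((k + ν j : ℕ) * (t j : ℂ)))) =
        Complex.exp (a * ∑ j, Complex.exp (Complex.I * (t j : ℂ))) ^ n *
          Complex.exp (-Complex.I * ∑ j, (t j : ℂ)) ^ k *
          Complex.exp (-Complex.I * ∑ j, ((ν j : ℂ) * (t j : ℂ))) := by
      simp_rw [← Complex.exp_nat_mul, ← Complex.exp_add, ← Complex.exp_sum, Finset.mul_sum,
        ← Finset.sum_add_distrib]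
      congr 1
      refine Finset.sum_congr rfl fun j _ => ?_
      push_cast
      ring
    rw [hprod, ← neg_mul, mul_pow, one_pow]
    ring
  simp_rw [hexpand]
  rw [integral_finsetSum]
  · refine Finset.sum_congr rfl fun k _ => ?_
    rw [integral_const_mul, volume_pi, Measure.restrict_pi_pi,
      integral_fintype_prod_eq_prod (fun (j : Fin r) (s : ℝ) =>
        Complex.exp (n * a * Complex.exp (Complex.I * (s : ℂ))) *
          Complex.exp (-Complex.I * ((k + ν j : ℕ) * (s : ℂ))))]
    simp_rw [setIntegral_exp_mul_exp_mul_exp_neg]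
  · intro k _
    refine ContinuousOn.integrableOn_compact (isCompact_univ_pi fun _ => isCompact_Icc) ?_
    fun_prop

/-- Saddle-point integral representation of `F_n(n^r ρ(φ))`. -/
theorem stmt_18 (r : ℕ) (hr : 1 ≤ r) (ν : Fin r → ℕ)
    (F : ℕ → ℝ → ℝ)
    (hF : ∀ n x, F n x = ∑ k ∈ Finset.range (n + 1),
      (n.choose k : ℝ) * (-x) ^ k / ∏ j, ((k + ν j).factorial : ℝ))
    (φ : ℝ) (hφ1 : 0 < φ) (hφ2 : φ < π / ((r : ℝ) + 1))
    (ρ A : ℝ)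
    (hρ : ρ = Real.sin (((r : ℝ) + 1) * φ) ^ (r + 1) /
      (Real.sin φ * Real.sin ((r : ℝ) * φ) ^ r))
    (hA : A = Real.sin (((r : ℝ) + 1) * φ) / Real.sin ((r : ℝ) * φ))
    (n : ℕ) (hn : 1 ≤ n) :
    (F n ((n : ℝ) ^ r * ρ) : ℂ) = (1 / (2 * (π : ℂ)) ^ r) *
      ((Real.sin ((r : ℝ) * φ) / ((n : ℝ) * Real.sin (((r : ℝ) + 1) * φ)) : ℝ) : ℂ) ^ (∑ j, ν j) *
      ∫ t in Set.univ.pi fun _ : Fin r => Set.Icc (-π) π,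
        (Complex.exp ((A : ℂ) * ∑ j, Complex.exp (Complex.I * (t j : ℂ))) *
            (1 - ((Real.sin (((r : ℝ) + 1) * φ) / Real.sin φ : ℝ) : ℂ) *
              Complex.exp (-Complex.I * ∑ j, (t j : ℂ)))) ^ n *
          Complex.exp (-Complex.I * ∑ j, ((ν j : ℂ) * (t j : ℂ))) := by
  have hr1 : (1 : ℝ) ≤ r := by exact_mod_cast hr
  have hφr : ((r : ℝ) + 1) * φ < π := by
    rw [lt_div_iff₀ (by linarith)] at hφ2
    linarith
  have hs1 : 0 < Real.sin (((r : ℝ) + 1) * φ) := Real.sin_pos_of_pos_of_lt_pi (by positivity) hφr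
  have hsr : 0 < Real.sin ((r : ℝ) * φ) :=
    Real.sin_pos_of_pos_of_lt_pi (by positivity) (by linarith)
  have hρA : ρ = A ^ r * (Real.sin (((r : ℝ) + 1) * φ) / Real.sin φ) := by
    rw [hρ, hA, pow_succ, div_pow, div_mul_div_comm, mul_comm (Real.sin φ)]
  have hA0 : (A : ℂ) ≠ 0 := by
    rw [hA]
    exact_mod_cast (div_pos hs1 hsr).ne'
  have hn0 : (n : ℂ) ≠ 0 := by exact_mod_cast (Nat.one_le_iff_ne_zero.mp hn)
  have hinv : ((Real.sin ((r : ℝ) * φ) / ((n : ℝ) * Real.sin (((r : ℝ) + 1) * φ)) : ℝ) : ℂ) =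
      ((n : ℂ) * A)⁻¹ := by
    rw [hA]
    push_cast
    rw [mul_div_assoc', inv_div]
  rw [hinv, setIntegral_exp_mul_one_sub_pow, hF, hρA]
  generalize Real.sin (((r : ℝ) + 1) * φ) / Real.sin φ = b
  push_cast
  rw [Finset.mul_sum]
  refine Finset.sum_congr rfl fun k _ => ?_
  have hpi : (π : ℂ) ≠ 0 := by exact_mod_cast pi_ne_zero
  have hnA : (n : ℂ) * A ≠ 0 := mul_ne_zero hn0 hA0
  have hfac : ∏ j, ((k + ν j).factorial : ℂ) ≠ 0 :=
    Finset.prod_ne_zero_iff.mpr fun j _ => by exact_mod_cast (k + ν j).factorial_ne_zero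
  rw [Finset.prod_mul_distrib, Finset.prod_div_distrib, Finset.prod_pow_eq_pow_sum,
    Finset.sum_add_distrib]
  simp only [Finset.prod_const, Finset.sum_const, Finset.card_univ, Fintype.card_fin, smul_eq_mul]
  rw [pow_add, inv_pow, pow_mul,
    show -((n : ℂ) ^ r * ((A : ℂ) ^ r * b)) = ((n : ℂ) * A) ^ r * -b by ring, mul_pow]
  field_simp
end

section
/- Let r ≥ 1, let a > 0, let D ⊆ ℂ^r be open with [−a,a]^r ⊆ D (via the embedding ℝ^r ⊆ ℂ^r), and let p, q : D → ℂ be holomorphic. Define I(n) = ∫_{[−a,a]^r} e^{−n p(t)} q(t) dt. Assume: all complex partial derivatives ∂p/∂t_j vanish at t = 0; the complex Hessian matrix H = (∂²p/∂t_j∂t_k(0)) satisfies det H ≠ 0; the real-valued function t ↦ Re p(t) on [−a,a]^r attains its minimum only at t = 0; det(Re H) ≠ 0; and q(0) ≠ 0. Then there exists s ∈ ℂ with s² = det H such that I(n) = (2π/n)^{r/2} e^{−n p(0)} (q(0)/s) (1 + o(1)) as n → ∞, i.e. I(n) · (n/(2π))^{r/2} e^{n p(0)} s / q(0) → 1. 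-/
open Real MeasureTheory Filter

/-- The directional derivative of a holomorphic function of several complex variables is
holomorphic. -/
theorem differentiableAt_fderiv_apply_of_differentiableOn {E : Type*} [NormedAddCommGroup E]
    [NormedSpace ℂ E] [FiniteDimensional ℂ E] {f : E → ℂ} {s : Set E}
    (hf : DifferentiableOn ℂ f s) (hs : IsOpen s) {x : E} (hx : x ∈ s) (v : E) :
    DifferentiableAt ℂ (fun z => fderiv ℂ f z v) x := by
  have : ProperSpace E := FiniteDimensional.proper ℂ E
  obtain ⟨δ, hδ, hδs⟩ : ∃ δ > 0, Metric.closedBall x (3 * δ) ⊆ s := by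
    obtain ⟨ε, hε, h⟩ := Metric.nhds_basis_closedBall.mem_iff.1 (hs.mem_nhds hx)
    exact ⟨ε / 3, by positivity, by convert h using 2; ring⟩
  obtain ⟨M, hM⟩ := (isCompact_closedBall x (3 * δ)).exists_bound_of_continuousOn
    (hf.continuousOn.mono hδs)
  have hdiff : ∀ z ∈ Metric.closedBall x (3 * δ), DifferentiableAt ℂ f z := fun z hz =>
    hf.differentiableAt (hs.mem_nhds (hδs hz))
  have hfd : ∀ z ∈ Metric.closedBall x (2 * δ), ‖fderiv ℂ f z‖ ≤ (2 * M) / δ := by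
    intro z hz
    have hsub : Metric.ball z δ ⊆ Metric.closedBall x (3 * δ) := by
      refine Metric.ball_subset_closedBall.trans (Metric.closedBall_subset_closedBall' ?_)
      have := Metric.mem_closedBall.1 hz
      linarith
    refine Complex.norm_fderiv_le_div_of_mapsTo_ball (R₁ := δ)
      (fun w hw => (hdiff w (hsub hw)).differentiableWithinAt) ?_ hδ
    intro w hw
    rw [mem_closedBall_iff_norm]
    have h1 := hM w (hsub hw)
    have h2 := hM z (hsub (Metric.mem_ball_self hδ))
    linarith [norm_sub_le (f w) (f z)]
  set R : ℝ := δ / (‖v‖ + 1) with hR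
  have hR0 : 0 < R := by positivity
  have hRv : R * ‖v‖ ≤ δ := by
    rw [hR, div_mul_eq_mul_div, div_le_iff₀ (by positivity)]
    nlinarith [norm_nonneg v]
  have hmem : ∀ z ∈ Metric.ball x δ, ∀ ζ : ℂ, ‖ζ‖ ≤ R →
      z + ζ • v ∈ Metric.closedBall x (2 * δ) := by
    intro z hz ζ hζ
    rw [mem_ball_iff_norm] at hz
    rw [mem_closedBall_iff_norm]
    calc ‖z + ζ • v - x‖ = ‖(z - x) + ζ • v‖ := by congr 1; abel
      _ ≤ ‖z - x‖ + ‖ζ‖ * ‖v‖ := (norm_add_le _ _).trans (by rw [norm_smul])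
      _ ≤ δ + R * ‖v‖ := by gcongr
      _ ≤ 2 * δ := by linarith
  have hmem' : ∀ z ∈ Metric.ball x δ, ∀ ζ : ℂ, ‖ζ‖ ≤ R → DifferentiableAt ℂ f (z + ζ • v) :=
    fun z hz ζ hζ => hdiff _ (Metric.closedBall_subset_closedBall (by linarith) (hmem z hz ζ hζ))
  have hcauchy : ∀ z ∈ Metric.ball x δ, fderiv ℂ f z v =
      (2 * π * Complex.I : ℂ)⁻¹ • ∮ w in C(0, R), ((w - 0) ^ 2)⁻¹ • f (z + w • v) := by
    intro z hz
    have hline : ∀ ζ : ℂ, HasDerivAt (fun w : ℂ => z + w • v) v ζ := fun ζ => by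
      simpa using ((hasDerivAt_id ζ).smul_const v).const_add z
    have h1 : deriv (fun w : ℂ => f (z + w • v)) 0 = fderiv ℂ f z v := by
      have h0 : HasFDerivAt f (fderiv ℂ f z) (z + (0 : ℂ) • v) := by
        simpa using (hmem' z hz 0 (by simpa using hR0.le)).hasFDerivAt
      exact (h0.comp_hasDerivAt (0 : ℂ) (hline 0)).deriv
    have h2 := Complex.two_pi_I_inv_smul_circleIntegral_sub_sq_inv_smul_of_differentiable
      (U := (fun w : ℂ => z + w • v) ⁻¹' s)
      (hs.preimage (by fun_prop)) (c := 0) (R := R) (w₀ := 0) (f := fun w => f (z + w • v)) ?_ ?_ ?_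
    · rw [← h1, ← h2]
    · intro ζ hζ
      exact hδs (Metric.closedBall_subset_closedBall (by linarith)
        (hmem z hz ζ (by simpa using hζ)))
    · intro ζ hζ
      exact (DifferentiableAt.comp ζ (hf.differentiableAt (hs.mem_nhds hζ))
        (hline ζ).differentiableAt).differentiableWithinAt
    · simpa using hR0
  have key : DifferentiableAt ℂ
      (fun z => ∮ w in C(0, R), ((w - 0) ^ 2)⁻¹ • f (z + w • v)) x := by
    have hk : Continuous (fun θ : ℝ => deriv (circleMap 0 R) θ * ((circleMap 0 R θ - 0) ^ 2)⁻¹) := by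
      simp only [deriv_circleMap]
      refine ((continuous_circleMap 0 R).mul continuous_const).mul
        (Continuous.inv₀ (((continuous_circleMap 0 R).sub continuous_const).pow 2) fun θ => ?_)
      simpa using hR0.ne'
    set k : ℝ → ℂ := fun θ => deriv (circleMap 0 R) θ * ((circleMap 0 R θ - 0) ^ 2)⁻¹
    have hcirc : ∀ θ, ‖circleMap 0 R θ‖ ≤ R := fun θ => by simp [abs_of_pos hR0]
    have hcont : ∀ z ∈ Metric.ball x δ,
        Continuous fun θ : ℝ => k θ * f (z + circleMap 0 R θ • v) := by
      intro z hz
      refine hk.mul (continuous_iff_continuousAt.2 fun θ => ?_)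
      exact ContinuousAt.comp (f := fun θ : ℝ => z + circleMap 0 R θ • v)
        (hmem' z hz _ (hcirc θ)).continuousAt
        (by have := continuous_circleMap 0 R; fun_prop)
    have := intervalIntegral.hasFDerivAt_integral_of_dominated_of_fderiv_le (𝕜 := ℂ) (μ := volume)
      (a := 0) (b := 2 * π) (F := fun z θ => k θ * f (z + circleMap 0 R θ • v))
      (F' := fun z θ => k θ • fderiv ℂ f (z + circleMap 0 R θ • v)) (x₀ := x)
      (bound := fun θ => ‖k θ‖ * (2 * M / δ)) (Metric.ball_mem_nhds x hδ) ?_ ?_ ?_ ?_ ?_ ?_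
    · refine this.differentiableAt.congr_of_eventuallyEq (Eventually.of_forall fun z => ?_)
      simp [circleIntegral, k, mul_assoc]
    · filter_upwards [Metric.ball_mem_nhds x hδ] with z hz
      exact (hcont z hz).aestronglyMeasurable
    · exact (hcont x (Metric.mem_ball_self hδ)).intervalIntegrable _ _
    · borelize E
      have : ProperSpace (E →L[ℂ] ℂ) := FiniteDimensional.proper ℂ _
      refine hk.aestronglyMeasurable.smul ?_
      refine Measurable.aestronglyMeasurable ?_
      refine (measurable_fderiv ℂ f).comp (Continuous.measurable ?_)
      have := continuous_circleMap 0 R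
      fun_prop
    · refine Eventually.of_forall fun θ _ z hz => ?_
      rw [norm_smul]
      gcongr
      exact hfd _ (hmem z hz _ (hcirc θ))
    · exact (hk.norm.mul continuous_const).intervalIntegrable _ _
    · refine Eventually.of_forall fun θ _ z hz => ?_
      have h := (hmem' z hz _ (hcirc θ)).hasFDerivAt.comp z
        ((hasFDerivAt_id z).add_const (circleMap 0 R θ • v))
      simpa using h.const_mul (k θ)
  refine (key.const_smul ((2 * π * Complex.I : ℂ)⁻¹)).congr_of_eventuallyEq ?_
  filter_upwards [Metric.ball_mem_nhds x hδ] with z hz using hcauchy z hz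

theorem differentiableAt_fderiv_of_differentiableOn {ι : Type*} [Fintype ι] [DecidableEq ι]
    {f : (ι → ℂ) → ℂ} {s : Set (ι → ℂ)}
    (hf : DifferentiableOn ℂ f s) (hs : IsOpen s) {x : ι → ℂ} (hx : x ∈ s) :
    DifferentiableAt ℂ (fderiv ℂ f) x := by
  have h : fderiv ℂ f = fun z => ∑ i, fderiv ℂ f z (Pi.single i 1) •
      (ContinuousLinearMap.proj i : (ι → ℂ) →L[ℂ] ℂ) := by
    ext z w
    conv_lhs => rw [pi_eq_sum_univ' w]
    simp [mul_comm]
  rw [h]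
  exact DifferentiableAt.fun_sum fun i _ =>
    (differentiableAt_fderiv_apply_of_differentiableOn hf hs hx _).smul_const _

/-- Second-order Taylor expansion at a point of a function whose derivative is differentiable
there. -/
theorem isLittleO_taylor_two {𝕜 E F : Type*} [RCLike 𝕜] [NormedAddCommGroup E] [NormedSpace 𝕜 E]
    [NormedAddCommGroup F] [NormedSpace 𝕜 F] {f : E → F}
    (hf : ∀ᶠ z in nhds (0 : E), DifferentiableAt 𝕜 f z)
    (hf' : DifferentiableAt 𝕜 (fderiv 𝕜 f) 0) :
    (fun z => f z - f 0 - fderiv 𝕜 f 0 z - (2⁻¹ : 𝕜) • fderiv 𝕜 (fderiv 𝕜 f) 0 z z)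
      =o[nhds 0] fun z => ‖z‖ ^ 2 := by
  let : NormedSpace ℝ E := .restrictScalars ℝ 𝕜 E
  set B := fderiv 𝕜 (fderiv 𝕜 f) 0 with hB
  have hsymm : ∀ v w, B v w = B w v :=
    second_derivative_symmetric_of_eventually (hf.mono fun _ h => h.hasFDerivAt) hf'.hasFDerivAt
  have hh : ∀ z, DifferentiableAt 𝕜 f z →
      HasFDerivAt (fun z => f z - f 0 - fderiv 𝕜 f 0 z - (2⁻¹ : 𝕜) • B z z)
        (fderiv 𝕜 f z - fderiv 𝕜 f 0 - B z) z := by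
    intro z hz
    have hq : HasFDerivAt (fun z => (2⁻¹ : 𝕜) • B z z) (B z) z := by
      refine (((B.hasFDerivAt (x := z)).clm_apply (hasFDerivAt_id z)).const_smul
        (2⁻¹ : 𝕜)).congr_fderiv ?_
      ext w
      simp [hsymm w z, ← two_smul 𝕜, smul_smul]
    exact ((hz.hasFDerivAt.sub_const (f 0)).sub (fderiv 𝕜 f 0).hasFDerivAt).sub hq
  refine Asymptotics.isLittleO_iff.2 fun c hc => ?_
  have h1 := (Asymptotics.isLittleO_iff.1 hf'.hasFDerivAt.isLittleO) hc
  obtain ⟨ε, hε, hball⟩ := Metric.eventually_nhds_iff_ball.1 (hf.and h1)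
  filter_upwards [Metric.ball_mem_nhds 0 hε] with z hz
  have hsub : Metric.closedBall (0 : E) ‖z‖ ⊆ Metric.ball 0 ε :=
    Metric.closedBall_subset_ball (by simpa using hz)
  have := Convex.norm_image_sub_le_of_norm_hasFDerivWithin_le (𝕜 := 𝕜) (C := c * ‖z‖)
    (s := Metric.closedBall (0 : E) ‖z‖) (x := 0) (y := z)
    (fun w hw => (hh w (hball w (hsub hw)).1).hasFDerivWithinAt) (fun w hw => ?_)
    (convex_closedBall _ _) (by simp) (by simp)
  · simpa [pow_two, mul_assoc] using this
  · have h2 := (hball w (hsub hw)).2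
    simp only [sub_zero] at h2
    refine h2.trans ?_
    gcongr
    simpa using hw

open scoped MatrixOrder Matrix.Norms.L2Operator in
/-- A positive definite and a symmetric real matrix can be simultaneously diagonalized by
congruence. -/
theorem Matrix.PosDef.exists_simultaneous_diagonalization {ι : Type*} [Fintype ι] [DecidableEq ι]
    {A B : Matrix ι ι ℝ} (hA : A.PosDef) (hB : B.IsHermitian) :
    ∃ (P : Matrix ι ι ℝ) (β : ι → ℝ), P.det ≠ 0 ∧ P.transpose * A * P = 1 ∧
      P.transpose * B * P = Matrix.diagonal β := by
  obtain ⟨M, hM, rfl⟩ := CStarAlgebra.isStrictlyPositive_iff_eq_star_mul_self.1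
    hA.isStrictlyPositive
  have hMdet : IsUnit M.det := (Matrix.isUnit_iff_isUnit_det M).1 hM
  have hC : (M⁻¹.transpose * B * M⁻¹).IsHermitian := by
    simpa using Matrix.isHermitian_conjTranspose_mul_mul M⁻¹ hB
  set U : Matrix ι ι ℝ := (hC.eigenvectorUnitary : Matrix ι ι ℝ)
  have hU : star U * U = 1 := Unitary.coe_star_mul_self hC.eigenvectorUnitary
  have hUt : U.transpose = star U := by
    rw [Matrix.star_eq_conjTranspose, Matrix.conjTranspose_eq_transpose_of_trivial]
  have hspec := hC.spectral_theorem
  rw [Unitary.conjStarAlgAut_apply] at hspec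
  refine ⟨M⁻¹ * U, hC.eigenvalues, ?_, ?_, ?_⟩
  · rw [Matrix.det_mul]
    refine mul_ne_zero ?_ ?_
    · exact (Matrix.isUnit_nonsing_inv_det M hMdet).ne_zero
    · intro h
      have := congrArg Matrix.det hU
      simp [h] at this
  · have h1 : M⁻¹.transpose * star M = 1 := by
      rw [Matrix.star_eq_conjTranspose, Matrix.conjTranspose_eq_transpose_of_trivial,
        ← Matrix.transpose_mul, Matrix.mul_nonsing_inv _ hMdet, Matrix.transpose_one]
    have h2 : M * M⁻¹ = 1 := Matrix.mul_nonsing_inv _ hMdet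
    calc (M⁻¹ * U).transpose * (star M * M) * (M⁻¹ * U)
        = star U * (M⁻¹.transpose * star M) * (M * M⁻¹) * U := by
          rw [Matrix.transpose_mul, hUt]; simp only [mul_assoc]
      _ = 1 := by rw [h1, h2, mul_one, mul_one, hU]
  · calc (M⁻¹ * U).transpose * B * (M⁻¹ * U)
        = star U * (M⁻¹.transpose * B * M⁻¹) * U := by
          rw [Matrix.transpose_mul, hUt]; simp only [mul_assoc]
      _ = (star U * U) * Matrix.diagonal (RCLike.ofReal ∘ hC.eigenvalues) * (star U * U) := by
          conv_lhs => rw [hspec]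
          simp only [mul_assoc, U]
      _ = Matrix.diagonal hC.eigenvalues := by
          rw [hU, one_mul, mul_one]; rfl

theorem integral_comp_mulVec {ι : Type*} [Fintype ι] [DecidableEq ι]
    {P : Matrix ι ι ℝ} (hP : P.det ≠ 0) (f : (ι → ℝ) → ℂ) :
    ∫ x, f x = |P.det| * ∫ x, f (P.mulVec x) := by
  have hemb : MeasurableEmbedding (Matrix.toLin' P) := by
    have hinj : Function.Injective (Matrix.toLin' P) :=
      Matrix.mulVec_injective_of_isUnit ((Matrix.isUnit_iff_isUnit_det P).2 hP.isUnit)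
    exact (LinearMap.isClosedEmbedding_of_injective (LinearMap.ker_eq_bot.2 hinj)).measurableEmbedding
  have h := hemb.integral_map (μ := volume) f
  rw [Real.map_matrix_volume_pi_eq_smul_volume_pi hP, integral_smul_measure] at h
  simp only [Matrix.toLin'_apply] at h
  rw [← h, ENNReal.toReal_ofReal (abs_nonneg _), abs_inv, Complex.real_smul, ← mul_assoc,
    ← Complex.ofReal_mul, mul_inv_cancel₀ (abs_ne_zero.2 hP), Complex.ofReal_one, one_mul]

/-- The square of the complex Gaussian integral attached to a symmetric matrix whose real part is
positive definite. -/
theorem sq_integral_cexp_quadratic_mul_det {ι : Type*} [Fintype ι] [DecidableEq ι]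
    {H : Matrix ι ι ℂ} (hH : H.IsSymm) (hre : (H.map Complex.re).PosDef) :
    (∫ x : ι → ℝ, Complex.exp (-(1 / 2) *
      ((fun i => (x i : ℂ)) ⬝ᵥ H.mulVec fun i => (x i : ℂ)))) ^ 2 * H.det =
      (2 * π) ^ Fintype.card ι := by
  have him : (H.map Complex.im).IsHermitian := by
    ext i j
    simp [← hH.apply i j]
  obtain ⟨P, β, hP, hPA, hPB⟩ := hre.exists_simultaneous_diagonalization him
  set Q : Matrix ι ι ℂ := P.map (algebraMap ℝ ℂ) with hQ
  have hHdecomp : H = (H.map Complex.re).map (algebraMap ℝ ℂ) +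
      Complex.I • (H.map Complex.im).map (algebraMap ℝ ℂ) := by
    ext i j
    simp [mul_comm Complex.I, Complex.re_add_im]
  have hdiag : Q.transpose * H * Q = Matrix.diagonal fun i => 1 + Complex.I * β i := by
    have hA := congrArg (fun X : Matrix ι ι ℝ => X.map (algebraMap ℝ ℂ)) hPA
    have hB := congrArg (fun X : Matrix ι ι ℝ => X.map (algebraMap ℝ ℂ)) hPB
    simp only [Matrix.map_mul] at hA hB
    have hQt : Q.transpose = P.transpose.map (algebraMap ℝ ℂ) := Matrix.transpose_map.symm
    rw [hQt, hHdecomp, mul_add, add_mul, Matrix.mul_smul, Matrix.smul_mul, hA, hB]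
    ext i j
    by_cases h : i = j
    · subst h; simp
    · simp [h]
  have hdet : (P.det : ℂ) ^ 2 * H.det = ∏ i, (1 + Complex.I * β i) := by
    have h1 : Q.det = (P.det : ℂ) := by
      simpa [hQ] using (RingHom.map_det (algebraMap ℝ ℂ) P).symm
    have h2 := congrArg Matrix.det hdiag
    rw [Matrix.det_mul, Matrix.det_mul, Matrix.det_transpose, Matrix.det_diagonal, h1] at h2
    rw [← h2]; ring
  have hquad : ∀ x : ι → ℝ, ((fun i => (P.mulVec x i : ℂ)) ⬝ᵥ H.mulVec
      fun i => (P.mulVec x i : ℂ)) = ∑ i, (1 + Complex.I * β i) * (x i : ℂ) ^ 2 := by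
    intro x
    have hx : (fun i => (P.mulVec x i : ℂ)) = Q.mulVec fun i => (x i : ℂ) := by
      ext i
      simp [Matrix.mulVec, dotProduct, hQ]
    rw [hx, Matrix.dotProduct_mulVec, Matrix.vecMul_mulVec, ← Matrix.dotProduct_mulVec,
      Matrix.mulVec_mulVec, hdiag]
    simp only [dotProduct, Matrix.mulVec_diagonal]
    exact Finset.sum_congr rfl fun i _ => by ring
  have hb : ∀ i, 0 < ((1 / 2 : ℂ) * (1 + Complex.I * β i)).re := fun i => by simp
  have hb0 : ∀ i, (1 + Complex.I * β i : ℂ) ≠ 0 := fun i h => by simpa [h] using hb i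
  rw [integral_comp_mulVec hP]
  simp only [hquad]
  have hprod : ∀ x : ι → ℝ, Complex.exp (-(1 / 2) * ∑ i, (1 + Complex.I * β i) * (x i : ℂ) ^ 2) =
      ∏ i, Complex.exp (-((1 / 2 : ℂ) * (1 + Complex.I * β i)) * (x i : ℂ) ^ 2) := by
    intro x
    rw [← Complex.exp_sum, Finset.mul_sum]
    congr 1
    exact Finset.sum_congr rfl fun i _ => by ring
  simp only [hprod]
  rw [integral_fintype_prod_volume_eq_prod (fun i (y : ℝ) =>
    Complex.exp (-((1 / 2 : ℂ) * (1 + Complex.I * β i)) * (y : ℂ) ^ 2))]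
  simp only [integral_gaussian_complex (hb _)]
  have habs : ((|P.det| : ℝ) : ℂ) ^ 2 = (P.det : ℂ) ^ 2 := by
    rw [← Complex.ofReal_pow, sq_abs, Complex.ofReal_pow]
  rw [mul_pow, habs, ← Finset.prod_pow, mul_right_comm, hdet, ← Finset.prod_mul_distrib,
    ← Finset.card_univ, ← Finset.prod_const]
  refine Finset.prod_congr rfl fun i _ => ?_
  rw [← Complex.cpow_nat_mul]
  have := hb0 i
  norm_num
  field_simp

theorem exists_pos_mul_sq_norm_le_of_homogeneous {E : Type*} [NormedAddCommGroup E]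
    [NormedSpace ℝ E] [ProperSpace E] {Q : E → ℝ} (hQ : Continuous Q)
    (hhom : ∀ (s : ℝ) (x : E), Q (s • x) = s ^ 2 * Q x) (hpos : ∀ x ≠ 0, 0 < Q x) :
    ∃ c > 0, ∀ x, c * ‖x‖ ^ 2 ≤ Q x := by
  have hQ0 : Q 0 = 0 := by simpa using hhom 0 0
  rcases (Metric.sphere (0 : E) 1).eq_empty_or_nonempty with hs | hs
  · refine ⟨1, one_pos, fun x => ?_⟩
    have hx : x = 0 := by
      by_contra hx
      have : ‖x‖⁻¹ • x ∈ Metric.sphere (0 : E) 1 := by simp [norm_smul, hx]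
      simp [hs] at this
    simp [hx, hQ0]
  · obtain ⟨y, hy, hmin⟩ := (isCompact_sphere (0 : E) 1).exists_isMinOn hs hQ.continuousOn
    refine ⟨Q y, hpos y fun h => by simp [h] at hy, fun x => ?_⟩
    by_cases hx : x = 0
    · simp [hx, hQ0]
    have h1 : Q y ≤ Q (‖x‖⁻¹ • x) := hmin (by simp [norm_smul, hx])
    have hx' : 0 < ‖x‖ := norm_pos_iff.2 hx
    rw [hhom, inv_pow, ← div_eq_inv_mul, le_div_iff₀ (by positivity)] at h1
    exact h1

/-- A function that is positive off the origin on a compact set and is equivalent near the origin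
to a definite quadratic form dominates a multiple of the squared norm. -/
theorem exists_pos_mul_sq_norm_le_of_isLittleO {E : Type*} [NormedAddCommGroup E]
    {K : Set E} (hK : IsCompact K) {φ Q : E → ℝ} (hφ : ContinuousOn φ K)
    (hpos : ∀ x ∈ K, x ≠ 0 → 0 < φ x) {c : ℝ} (hc : 0 < c) (hQ : ∀ x, c * ‖x‖ ^ 2 ≤ Q x)
    (ho : (fun x => φ x - Q x) =o[nhds 0] fun x => ‖x‖ ^ 2) :
    ∃ d > 0, ∀ x ∈ K, d * ‖x‖ ^ 2 ≤ φ x := by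
  obtain ⟨ε, hε, hball⟩ := Metric.eventually_nhds_iff_ball.1
    (Asymptotics.isLittleO_iff.1 ho (half_pos hc))
  have hin : ∀ x ∈ Metric.ball (0 : E) ε, c / 2 * ‖x‖ ^ 2 ≤ φ x := fun x hx => by
    have h := hball x hx
    rw [norm_pow, norm_norm, Real.norm_eq_abs] at h
    linarith [(abs_le.1 h).1, hQ x]
  rcases (K \ Metric.ball (0 : E) ε).eq_empty_or_nonempty with hs | hs
  · exact ⟨c / 2, half_pos hc, fun x hx => hin x (Set.sdiff_eq_empty.1 hs hx)⟩
  obtain ⟨y, hy, hmin⟩ := (hK.diff Metric.isOpen_ball).exists_isMinOn hs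
    (hφ.mono Set.sdiff_subset)
  have hy0 : 0 < φ y := hpos y hy.1 fun h => hy.2 (by simpa [h] using hε)
  obtain ⟨S, hS⟩ := hK.isBounded.exists_norm_le
  have hS1 : (0 : ℝ) < S ^ 2 + 1 := by positivity
  refine ⟨min (c / 2) (φ y / (S ^ 2 + 1)), by positivity, fun x hx => ?_⟩
  by_cases hxb : x ∈ Metric.ball (0 : E) ε
  · refine le_trans ?_ (hin x hxb)
    gcongr
    exact min_le_left _ _
  · calc min (c / 2) (φ y / (S ^ 2 + 1)) * ‖x‖ ^ 2 ≤ φ y / (S ^ 2 + 1) * (S ^ 2 + 1) := by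
          gcongr
          · exact min_le_right _ _
          · nlinarith [norm_nonneg x, hS x hx]
      _ = φ y := by field_simp
      _ ≤ φ x := hmin ⟨hx, hxb⟩

theorem tendsto_inv_sqrt_natCast_smul {E : Type*} [NormedAddCommGroup E] [NormedSpace ℝ E]
    (u : E) : Tendsto (fun n : ℕ => (√(n : ℝ))⁻¹ • u) atTop (nhds 0) := by
  have h : Tendsto (fun n : ℕ => (√(n : ℝ))⁻¹) atTop (nhds 0) :=
    (Real.tendsto_sqrt_atTop.comp tendsto_natCast_atTop_atTop).inv_tendsto_atTop
  simpa using h.smul_const u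

theorem tendsto_natCast_mul_comp_inv_sqrt_smul {E : Type*} [NormedAddCommGroup E]
    [NormedSpace ℝ E] {φ Q : E → ℂ} (hhom : ∀ (s : ℝ) (x : E), Q (s • x) = (s : ℂ) ^ 2 * Q x)
    (ho : (fun x => φ x - Q x) =o[nhds 0] fun x => ‖x‖ ^ 2) (u : E) :
    Tendsto (fun n : ℕ => (n : ℂ) * φ ((√(n : ℝ))⁻¹ • u)) atTop (nhds (Q u)) := by
  have h1 := ho.comp_tendsto (tendsto_inv_sqrt_natCast_smul u)
  have h2 : (fun n : ℕ => (n : ℂ) * φ ((√(n : ℝ))⁻¹ • u) - Q u) =o[atTop]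
      fun _ => (1 : ℝ) := by
    have h0 : (fun n : ℕ => (n : ℂ)) =O[atTop] fun n : ℕ => (n : ℝ) :=
      Asymptotics.IsBigO.of_bound 1 (by simp)
    have h3 := h0.mul_isLittleO h1
    refine (h3.congr' ?_ EventuallyEq.rfl).trans_isBigO ?_
    · filter_upwards [eventually_gt_atTop 0] with n hn
      have hn' : (n : ℂ) ≠ 0 := by exact_mod_cast hn.ne'
      have hs : (((√(n : ℝ))⁻¹ : ℝ) : ℂ) ^ 2 = (n : ℂ)⁻¹ := by
        rw [← Complex.ofReal_pow, inv_pow, Real.sq_sqrt (Nat.cast_nonneg n)]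
        simp
      simp only [Function.comp_apply, hhom, hs]
      field_simp
    · refine Asymptotics.IsBigO.of_bound (‖u‖ ^ 2) ?_
      filter_upwards [eventually_gt_atTop 0] with n hn
      have hn' : (0 : ℝ) < n := by exact_mod_cast hn
      simp only [Function.comp_apply, norm_smul, norm_mul, norm_pow, norm_inv,
        mul_pow, inv_pow, Real.norm_eq_abs, sq_abs,
        Real.sq_sqrt hn'.le, norm_one]
      field_simp
      rfl
  simpa using ((Asymptotics.isLittleO_one_iff ℝ).1 h2).add_const (Q u)

theorem integrable_exp_neg_mul_sq_norm_pi {ι : Type*} [Fintype ι] [Nonempty ι] {c : ℝ}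
    (hc : 0 < c) : Integrable fun x : ι → ℝ => Real.exp (-c * ‖x‖ ^ 2) := by
  have hcard : (0 : ℝ) < Fintype.card ι := by exact_mod_cast Fintype.card_pos
  have h := Integrable.fintype_prod (ι := ι) (μ := fun _ => (volume : Measure ℝ))
    (f := fun _ y => Real.exp (-(c / Fintype.card ι) * y ^ 2))
    fun _ => integrable_exp_neg_mul_sq (by positivity)
  refine Integrable.mono' h (by fun_prop) (Eventually.of_forall fun x => ?_)
  rw [Real.norm_eq_abs, Real.abs_exp, ← Real.exp_sum, Real.exp_le_exp, ← Finset.mul_sum, neg_mul,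
    neg_mul, neg_le_neg_iff, div_mul_eq_mul_div, div_le_iff₀ hcard, mul_assoc]
  gcongr
  calc ∑ i, x i ^ 2 ≤ ∑ _i : ι, ‖x‖ ^ 2 := Finset.sum_le_sum fun i _ =>
        sq_le_sq.2 (by simpa using norm_le_pi_norm x i)
    _ = ‖x‖ ^ 2 * Fintype.card ι := by simp [mul_comm]

/-- **Laplace's method** with a complex phase, whose real part has a nondegenerate minimum at the
origin. -/
theorem tendsto_sqrt_pow_mul_setIntegral_cexp {ι : Type*} [Fintype ι] [Nonempty ι]
    {K : Set (ι → ℝ)} (hK : IsCompact K) (hK0 : K ∈ nhds 0) {φ g Q : (ι → ℝ) → ℂ}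
    (hφ : ContinuousOn φ K) (hg : ContinuousOn g K)
    (hhom : ∀ (s : ℝ) (x : ι → ℝ), Q (s • x) = (s : ℂ) ^ 2 * Q x)
    (ho : (fun x => φ x - Q x) =o[nhds 0] fun x => ‖x‖ ^ 2)
    {c : ℝ} (hc : 0 < c) (hre : ∀ x ∈ K, c * ‖x‖ ^ 2 ≤ (φ x).re) :
    Tendsto (fun n : ℕ => ((√(n : ℝ) : ℝ) : ℂ) ^ Fintype.card ι *
        ∫ x in K, Complex.exp (-(n : ℂ) * φ x) * g x)
      atTop (nhds (∫ x, Complex.exp (-Q x) * g 0)) := by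
  obtain ⟨M, hM⟩ := hK.exists_bound_of_continuousOn hg
  set f : ℕ → (ι → ℝ) → ℂ := fun n => K.indicator fun x => Complex.exp (-(n : ℂ) * φ x) * g x
  have hscale : ∀ᶠ n : ℕ in atTop, ∫ u, f n ((√(n : ℝ))⁻¹ • u) =
      ((√(n : ℝ) : ℝ) : ℂ) ^ Fintype.card ι * ∫ x in K, Complex.exp (-(n : ℂ) * φ x) * g x := by
    filter_upwards with n
    rw [Measure.integral_comp_smul, integral_indicator hK.measurableSet]
    simp [abs_of_nonneg (Real.sqrt_nonneg _)]
  refine Tendsto.congr' hscale ?_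
  refine tendsto_integral_filter_of_dominated_convergence
    (fun u => M * Real.exp (-c * ‖u‖ ^ 2)) ?_ ?_
    ((integrable_exp_neg_mul_sq_norm_pi hc).const_mul M) ?_
  · refine Eventually.of_forall fun n => ?_
    have hpre : (fun u => f n ((√(n : ℝ))⁻¹ • u)) =
        ((fun u => (√(n : ℝ))⁻¹ • u) ⁻¹' K).indicator
        ((fun x => Complex.exp (-(n : ℂ) * φ x) * g x) ∘ fun u => (√(n : ℝ))⁻¹ • u) :=
      funext fun _ => (Set.indicator_comp_right _).symm
    have hcont : Continuous fun u : ι → ℝ => (√(n : ℝ))⁻¹ • u := by fun_prop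
    have hmeas := hK.measurableSet.preimage hcont.measurable
    rw [hpre, aestronglyMeasurable_indicator_iff hmeas]
    refine ContinuousOn.aestronglyMeasurable ?_ hmeas
    exact ContinuousOn.comp (t := K) (by fun_prop) hcont.continuousOn fun _ h => h
  · filter_upwards [eventually_gt_atTop 0] with n hn
    refine Eventually.of_forall fun u => ?_
    have hn' : (0 : ℝ) < n := by exact_mod_cast hn
    have hM0 : 0 ≤ M := (norm_nonneg _).trans (hM 0 (mem_of_mem_nhds hK0))
    by_cases hu : (√(n : ℝ))⁻¹ • u ∈ K
    · simp only [f, Set.indicator_of_mem hu, norm_mul, Complex.norm_exp]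
      rw [mul_comm]
      gcongr
      · exact hM _ hu
      · have h := mul_le_mul_of_nonneg_left (hre _ hu) hn'.le
        rw [norm_smul, mul_pow, norm_inv, inv_pow, Real.norm_eq_abs, sq_abs,
          Real.sq_sqrt hn'.le] at h
        have h' : (n : ℝ) * (c * ((n : ℝ)⁻¹ * ‖u‖ ^ 2)) = c * ‖u‖ ^ 2 := by field_simp
        simp only [neg_mul, Complex.neg_re, Complex.mul_re, Complex.natCast_re,
          Complex.natCast_im, zero_mul, sub_zero]
        linarith
    · simp only [f, Set.indicator_of_notMem hu, norm_zero]
      positivity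
  · refine Eventually.of_forall fun u => ?_
    have h0 := tendsto_inv_sqrt_natCast_smul u
    have hlim : Tendsto (fun n : ℕ => Complex.exp (-(n : ℂ) * φ ((√(n : ℝ))⁻¹ • u)) *
        g ((√(n : ℝ))⁻¹ • u)) atTop (nhds (Complex.exp (-Q u) * g 0)) := by
      refine Tendsto.mul ?_ ((hg.continuousAt hK0).tendsto.comp h0)
      simpa only [neg_mul] using
        (tendsto_natCast_mul_comp_inv_sqrt_smul hhom ho u).neg.cexp
    refine hlim.congr' ?_
    filter_upwards [h0.eventually_mem hK0] with n hn
    simp [f, Set.indicator_of_mem hn]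

/-- Second-order expansion, in terms of the Hessian matrix, of a holomorphic function restricted to
`ℝ^ι` at a critical point. -/
theorem isLittleO_sub_hessian_of_differentiableOn {ι : Type*} [Fintype ι] [DecidableEq ι]
    {D : Set (ι → ℂ)} (hD : IsOpen D) (h0 : 0 ∈ D) {p : (ι → ℂ) → ℂ}
    (hp : DifferentiableOn ℂ p D) (hgrad : ∀ j, fderiv ℂ p 0 (Pi.single j 1) = 0)
    {H : Matrix ι ι ℂ}
    (hH : ∀ j k, H j k = fderiv ℂ (fun z => fderiv ℂ p z (Pi.single k 1)) 0 (Pi.single j 1)) :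
    H.IsSymm ∧ (fun t : ι → ℝ => (p (fun j => (t j : ℂ)) - p 0) -
      1 / 2 * ((fun i => (t i : ℂ)) ⬝ᵥ H.mulVec fun i => (t i : ℂ)))
      =o[nhds 0] fun t => ‖t‖ ^ 2 := by
  have hd : ∀ᶠ z in nhds (0 : ι → ℂ), DifferentiableAt ℂ p z := by
    filter_upwards [hD.mem_nhds h0] with z hz using hp.differentiableAt (hD.mem_nhds hz)
  have hd2 := differentiableAt_fderiv_of_differentiableOn hp hD h0
  have hB : ∀ j k, H j k = fderiv ℂ (fderiv ℂ p) 0 (Pi.single j 1) (Pi.single k 1) := by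
    intro j k
    rw [hH, fderiv_clm_apply hd2 (differentiableAt_const _)]
    simp
  have hgrad0 : fderiv ℂ p 0 = 0 := by
    ext w
    rw [pi_eq_sum_univ' w]
    simp [hgrad]
  refine ⟨Matrix.IsSymm.ext fun j k => ?_, ?_⟩
  · rw [hB, hB]
    exact second_derivative_symmetric_of_eventually (hd.mono fun _ h => h.hasFDerivAt)
      hd2.hasFDerivAt _ _
  have hBH : ∀ z : ι → ℂ, fderiv ℂ (fderiv ℂ p) 0 z z = z ⬝ᵥ H.mulVec z := by
    intro z
    conv_lhs => rw [pi_eq_sum_univ' z]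
    simp only [map_sum, map_smul, _root_.sum_apply, _root_.smul_apply,
      ← hB, dotProduct, Matrix.mulVec, smul_eq_mul, Finset.mul_sum]
    rw [Finset.sum_comm]
    exact Finset.sum_congr rfl fun i _ => Finset.sum_congr rfl fun j _ => by ring
  have hemb : Tendsto (fun (t : ι → ℝ) (j : ι) => (t j : ℂ)) (nhds 0) (nhds 0) := by
    have : Continuous fun (t : ι → ℝ) (j : ι) => (t j : ℂ) := by fun_prop
    simpa [Pi.zero_def] using this.tendsto 0
  have h := (isLittleO_taylor_two hd hd2).comp_tendsto hemb
  have hnorm : ∀ t : ι → ℝ, ‖fun j => (t j : ℂ)‖ = ‖t‖ := fun t => by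
    simp [Pi.norm_def, Complex.nnnorm_real]
  refine h.congr (fun t => ?_) fun t => ?_
  · simp [hgrad0, hBH]
  · simp [hnorm]

/-- Multivariate saddle point method: asymptotics of
`I(n) = ∫_{[−a,a]^r} e^{−n p(t)} q(t) dt` for a simple saddle point at `0`. -/
theorem stmt_19 (r : ℕ) (hr : 1 ≤ r) (a : ℝ) (ha : 0 < a)
    (D : Set (Fin r → ℂ)) (hD : IsOpen D)
    (hDa : ∀ t : Fin r → ℝ, (∀ j, t j ∈ Set.Icc (-a) a) → (fun j => (t j : ℂ)) ∈ D)
    (p q : (Fin r → ℂ) → ℂ)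
    (hp : DifferentiableOn ℂ p D) (hq : DifferentiableOn ℂ q D)
    (I : ℕ → ℂ)
    (hI : ∀ n : ℕ, I n = ∫ t in Set.univ.pi fun _ : Fin r => Set.Icc (-a) a,
      Complex.exp (-(n : ℂ) * p fun j => ((t j : ℝ) : ℂ)) * q fun j => ((t j : ℝ) : ℂ))
    (hgrad : ∀ j : Fin r, fderiv ℂ p 0 (Pi.single j 1) = 0)
    (H : Matrix (Fin r) (Fin r) ℂ)
    (hH : ∀ j k : Fin r,
      H j k = fderiv ℂ (fun z => fderiv ℂ p z (Pi.single k 1)) 0 (Pi.single j 1))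
    (hdetH : H.det ≠ 0)
    (hmin : ∀ t : Fin r → ℝ, (∀ j, t j ∈ Set.Icc (-a) a) → t ≠ 0 →
      (p 0).re < (p fun j => ((t j : ℝ) : ℂ)).re)
    (hdetReH : (Matrix.of fun j k => (H j k).re).det ≠ 0)
    (hq0 : q 0 ≠ 0) :
    ∃ s : ℂ, s ^ 2 = H.det ∧
      Tendsto (fun n : ℕ =>
          I n * (((((n : ℝ) / (2 * π)) ^ ((r : ℝ) / 2) : ℝ)) : ℂ) *
            Complex.exp ((n : ℂ) * p 0) * s / q 0)
        atTop (nhds 1) := by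
  have : Nonempty (Fin r) := ⟨⟨0, hr⟩⟩
  set K : Set (Fin r → ℝ) := Set.univ.pi fun _ : Fin r => Set.Icc (-a) a with hKdef
  have hKmem : ∀ t, t ∈ K ↔ ∀ j, t j ∈ Set.Icc (-a) a := fun t => by
    simp only [hKdef, Set.mem_univ_pi]
  have hK : IsCompact K := isCompact_univ_pi fun _ => isCompact_Icc
  have hK0 : K ∈ nhds 0 := set_pi_mem_nhds Set.finite_univ fun _ _ =>
    Icc_mem_nhds (by simpa using ha) (by simpa using ha)
  have h0D : (0 : Fin r → ℂ) ∈ D := by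
    simpa [Pi.zero_def] using hDa 0 ((hKmem 0).1 (mem_of_mem_nhds hK0))
  obtain ⟨hsymm, ho⟩ := isLittleO_sub_hessian_of_differentiableOn hD h0D hp hgrad hH
  set Q : (Fin r → ℝ) → ℂ := fun t =>
    1 / 2 * ((fun i => (t i : ℂ)) ⬝ᵥ H.mulVec fun i => (t i : ℂ)) with hQ
  set φ : (Fin r → ℝ) → ℂ := fun t => p (fun j => (t j : ℂ)) - p 0 with hφdef
  have hz : (fun j : Fin r => (((0 : Fin r → ℝ) j : ℝ) : ℂ)) = 0 := by ext; simp
  have hφ0 : φ 0 = 0 := by simp only [hφdef, hz, sub_self]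
  have hmaps : Set.MapsTo (fun (t : Fin r → ℝ) (j : Fin r) => (t j : ℂ)) K D := fun t ht =>
    hDa t ((hKmem t).1 ht)
  have hemb : Continuous fun (t : Fin r → ℝ) (j : Fin r) => (t j : ℂ) := by fun_prop
  have hφ : ContinuousOn φ K :=
    (hp.continuousOn.comp hemb.continuousOn hmaps).sub continuousOn_const
  have hg : ContinuousOn (fun t : Fin r → ℝ => q fun j => (t j : ℂ)) K :=
    hq.continuousOn.comp hemb.continuousOn hmaps
  have hφpos : ∀ t ∈ K, t ≠ 0 → 0 < (φ t).re := fun t ht h => by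
    simpa [hφdef] using hmin t ((hKmem t).1 ht) h
  have hhom : ∀ (s : ℝ) (x : Fin r → ℝ), Q (s • x) = (s : ℂ) ^ 2 * Q x := fun s x => by
    have : (fun i => ((s • x) i : ℂ)) = (s : ℂ) • fun i => (x i : ℂ) := by ext; simp
    simp only [hQ]
    rw [this, Matrix.mulVec_smul, smul_dotProduct, dotProduct_smul, smul_eq_mul, smul_eq_mul]
    ring
  have hQre : ∀ x : Fin r → ℝ, (Q x).re = 1 / 2 * (x ⬝ᵥ (H.map Complex.re).mulVec x) := by
    intro x
    simp [hQ, dotProduct, Matrix.mulVec]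
  have hhomre : ∀ (s : ℝ) (x : Fin r → ℝ), (Q (s • x)).re = s ^ 2 * (Q x).re := fun s x => by
    rw [hhom, ← Complex.ofReal_pow, Complex.re_ofReal_mul]
  have hpsd : (H.map Complex.re).PosSemidef := by
    refine .of_dotProduct_mulVec_nonneg ?_ fun x => ?_
    · ext i j
      simp [← hsymm.apply i j]
    · have hlim := (Complex.continuous_re.tendsto _).comp
        (tendsto_natCast_mul_comp_inv_sqrt_smul hhom ho x)
      have hnonneg : 0 ≤ (Q x).re := by
        refine ge_of_tendsto hlim ?_
        filter_upwards [(tendsto_inv_sqrt_natCast_smul x).eventually_mem hK0] with n hn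
        simp only [Function.comp_apply, Complex.mul_re, Complex.natCast_re, Complex.natCast_im,
          zero_mul, sub_zero]
        refine mul_nonneg n.cast_nonneg ?_
        by_cases h : (√(n : ℝ))⁻¹ • x = 0
        · change 0 ≤ (φ ((√(n : ℝ))⁻¹ • x)).re
          rw [h, hφ0, Complex.zero_re]
        · exact (hφpos _ hn h).le
      rw [hQre] at hnonneg
      simpa using hnonneg
  have hpd : (H.map Complex.re).PosDef := hpsd.posDef_iff_det_ne_zero.2 hdetReH
  obtain ⟨c, hc, hcQ⟩ := exists_pos_mul_sq_norm_le_of_homogeneous (Q := fun x => (Q x).re)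
    (by simp only [hQre]; fun_prop) hhomre fun x hx => by
      have := hpd.dotProduct_mulVec_pos hx
      rw [hQre]
      simpa using this
  have hore : (fun x => (φ x).re - (Q x).re) =o[nhds 0] fun x => ‖x‖ ^ 2 :=
    have hO : (fun x => (φ x).re - (Q x).re) =O[nhds 0] fun x => φ x - Q x :=
      .of_bound 1 (Eventually.of_forall fun x => by
        rw [one_mul, Real.norm_eq_abs, ← Complex.sub_re]
        exact Complex.abs_re_le_norm _)
    hO.trans_isLittleO ho
  obtain ⟨d, hd, hdφ⟩ := exists_pos_mul_sq_norm_le_of_isLittleO hK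
    (Complex.continuous_re.comp_continuousOn hφ) hφpos hc hcQ hore
  have hlap := tendsto_sqrt_pow_mul_setIntegral_cexp hK hK0 hφ hg hhom ho hd hdφ
  rw [integral_mul_const, Fintype.card_fin] at hlap
  have hgauss := sq_integral_cexp_quadratic_mul_det hsymm hpd
  rw [Fintype.card_fin] at hgauss
  set G : ℂ := ∫ x, Complex.exp (-Q x) with hG
  have hG' : (∫ x : Fin r → ℝ, Complex.exp (-(1 / 2) *
      ((fun i => (x i : ℂ)) ⬝ᵥ H.mulVec fun i => (x i : ℂ)))) = G := by
    simp only [hG, hQ, neg_mul]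
  rw [hG'] at hgauss
  have hπ : (0 : ℝ) < 2 * π := by positivity
  have hpow0 : (2 * π : ℂ) ^ r ≠ 0 := pow_ne_zero _ (by exact_mod_cast hπ.ne')
  have hG0 : G ≠ 0 := by
    rintro h
    rw [h] at hgauss
    simp only [ne_eq, OfNat.ofNat_ne_zero, not_false_eq_true, zero_pow, zero_mul] at hgauss
    exact hpow0 hgauss.symm
  have hsq : (((√(2 * π) : ℝ) : ℂ) ^ r) ^ 2 = (2 * π : ℂ) ^ r := by
    rw [← pow_mul, mul_comm r 2, pow_mul, ← Complex.ofReal_pow, Real.sq_sqrt hπ.le]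
    push_cast
    rfl
  have hroot0 : ((√(2 * π) : ℝ) : ℂ) ^ r ≠ 0 :=
    pow_ne_zero _ (by exact_mod_cast (Real.sqrt_pos.2 hπ).ne')
  refine ⟨((√(2 * π) : ℝ) : ℂ) ^ r / G, ?_, ?_⟩
  · rw [div_pow, hsq, ← hgauss]
    field_simp
  have hfin := hlap.mul_const ((G * q 0)⁻¹)
  rw [hz, mul_inv_cancel₀ (mul_ne_zero hG0 hq0)] at hfin
  refine hfin.congr fun n => ?_
  have hInt : I n * Complex.exp ((n : ℂ) * p 0) =
      ∫ x in K, Complex.exp (-(n : ℂ) * φ x) * q fun j => (x j : ℂ) := by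
    rw [hI, ← integral_mul_const]
    refine integral_congr_ae (Eventually.of_forall fun x => ?_)
    have : -(n : ℂ) * φ x = -(n : ℂ) * p (fun j => (x j : ℂ)) + n * p 0 := by
      simp only [hφdef]; ring
    simp only [this, Complex.exp_add]
    ring
  have hrpow : ((((n : ℝ) / (2 * π)) ^ ((r : ℝ) / 2) : ℝ) : ℂ) =
      ((√(n : ℝ) : ℝ) : ℂ) ^ r / ((√(2 * π) : ℝ) : ℂ) ^ r := by
    rw [← Complex.ofReal_pow, ← Complex.ofReal_pow, ← Complex.ofReal_div, ← div_pow,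
      ← Real.sqrt_div n.cast_nonneg, Real.sqrt_eq_rpow, ← Real.rpow_natCast,
      ← Real.rpow_mul (by positivity)]
    congr 2
    ring
  rw [← hInt, hrpow]
  field_simp
end
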